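/- arXiv:2105.02108 — 12 statements merged into one kernel-verified Lean document; each statement's English description precedes it below -/
import Mathlib

section
/- Let V : ℝ² → ℝ be of class C¹ and let z : [0,1] → ℝ² be of class C² with z(0) = z₀, z(1) = z₁, V(z(t)) > 0 for every t ∈ [0,1], and ∫₀¹ |ż(t)|² dt > 0. Assume z is a critical point of the Maupertuis functional M(y) = (½∫₀¹ |ẏ(t)|² dt)·(∫₀¹ V(y(t)) dt), i.e. for every C¹ map v : [0,1] → ℝ² with v(0) = v(1) = 0 the derivative at ε = 0 of ε ↦ (½∫₀¹ |ż(t)+εv̇(t)|² dt)·(∫₀¹ V(z(t)+εv(t)) dt) vanishes. Set λ = √( (∫₀¹ V(z(t)) dt) / (½∫₀¹ |ż(t)|² dt) ). Then the reparametrized curve u(s) := z(λs), s ∈ [0,1/λ], is a classical solution of u''(s) = ∇V(u(s)) satisfying the zero-energy relation ½|u'(s)|² − V(u(s)) = 0 for all s ∈ [0,1/λ], with u(0) = z₀ and u(1/λ) = z₁. -/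
noncomputable section

open Set



theorem aux_param (F F' : ℝ → ℝ → ℝ) (hF : Continuous (fun p : ℝ × ℝ => F p.1 p.2))
    (hF' : Continuous (fun p : ℝ × ℝ => F' p.1 p.2))
    (hd : ∀ x t, HasDerivAt (fun y => F y t) (F' x t) x) :
    HasDerivAt (fun x => ∫ t in (0:ℝ)..1, F x t) (∫ t in (0:ℝ)..1, F' 0 t) 0 := by
  have hK : IsCompact ((Icc (-1:ℝ) 1) ×ˢ (Icc (0:ℝ) 1)) := isCompact_Icc.prod isCompact_Icc
  obtain ⟨C, hC⟩ := hK.exists_bound_of_continuousOn hF'.continuousOn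
  have c1 : ∀ x, Continuous (F x) := fun x => by
    exact hF.comp (by fun_prop : Continuous (fun t : ℝ => (x, t)))
  have c2 : ∀ x, Continuous (F' x) := fun x => by
    exact hF'.comp (by fun_prop : Continuous (fun t : ℝ => (x, t)))
  refine (intervalIntegral.hasDerivAt_integral_of_dominated_loc_of_deriv_le
    (s := Icc (-1:ℝ) 1) (bound := fun _ => C) (F := F) (F' := F')
    (Icc_mem_nhds (by norm_num) (by norm_num)) ?_ ?_ ?_ ?_ ?_ ?_).2
  · exact Filter.Eventually.of_forall fun x => (c1 x).aestronglyMeasurable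
  · exact (c1 0).intervalIntegrable _ _
  · exact (c2 0).aestronglyMeasurable
  · refine Filter.Eventually.of_forall fun t ht x hx => hC (x, t) ⟨hx, ?_⟩
    rw [uIoc_of_le zero_le_one] at ht
    exact ⟨ht.1.le, ht.2⟩
  · exact intervalIntegrable_const
  · exact Filter.Eventually.of_forall fun t ht x hx => hd x t

/-- Integration by parts against a curve vanishing at the endpoints. -/
theorem aux_parts (f f' v v' : ℝ → EuclideanSpace ℝ (Fin 2)) (hf' : Continuous f') (hv' : Continuous v')
    (hf : ∀ t, HasDerivAt f (f' t) t) (hv : ∀ t, HasDerivAt v (v' t) t)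
    (h0 : v 0 = 0) (h1 : v 1 = 0) :
    ∫ t in (0:ℝ)..1, inner ℝ (f t) (v' t) = - ∫ t in (0:ℝ)..1, inner ℝ (f' t) (v t) := by
  have cf : Continuous f := continuous_iff_continuousAt.2 fun t => (hf t).continuousAt
  have cv : Continuous v := continuous_iff_continuousAt.2 fun t => (hv t).continuousAt
  have i1 : IntervalIntegrable (fun t => (inner ℝ (f t) (v' t) : ℝ)) MeasureTheory.volume 0 1 :=
    (cf.inner hv').intervalIntegrable _ _
  have i2 : IntervalIntegrable (fun t => (inner ℝ (f' t) (v t) : ℝ)) MeasureTheory.volume 0 1 :=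
    (hf'.inner cv).intervalIntegrable _ _
  have h := intervalIntegral.integral_eq_sub_of_hasDerivAt (a := 0) (b := 1)
    (fun t _ => (hf t).inner ℝ (hv t)) (i1.add i2)
  rw [intervalIntegral.integral_add i1 i2, h0, h1] at h
  simp only [inner_zero_right, sub_zero] at h
  linarith

theorem aux_zero_ext (F : ℝ → EuclideanSpace ℝ (Fin 2)) (hF : Continuous F) (h : ∀ t ∈ Ioo (0:ℝ) 1, F t = 0) :
    ∀ t ∈ Icc (0:ℝ) 1, F t = 0 := by
  intro t ht
  have hc : IsClosed {t | F t = 0} := isClosed_eq hF continuous_const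
  have : closure (Ioo (0:ℝ) 1) ⊆ {t | F t = 0} := closure_minimal h hc
  rw [closure_Ioo zero_ne_one] at this
  exact this ht

theorem aux_fund (F : ℝ → EuclideanSpace ℝ (Fin 2)) (hF : Continuous F)
    (h : ∀ v : ℝ → EuclideanSpace ℝ (Fin 2), ContDiff ℝ 1 v → v 0 = 0 → v 1 = 0 →
      ∫ t in (0:ℝ)..1, inner ℝ (F t) (v t) = 0) :
    ∀ t ∈ Icc (0:ℝ) 1, F t = 0 := by
  set w : ℝ → EuclideanSpace ℝ (Fin 2) := fun t => ∫ s in (0:ℝ)..t, F s with hw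
  have dw : ∀ t, HasDerivAt w (F t) t := fun t =>
    intervalIntegral.integral_hasDerivAt_right (hF.intervalIntegrable _ _)
      (hF.stronglyMeasurableAtFilter _ _) hF.continuousAt
  have cw : Continuous w := continuous_iff_continuousAt.2 fun t => (dw t).continuousAt
  set c : EuclideanSpace ℝ (Fin 2) := ∫ s in (0:ℝ)..1, w s with hc
  set v : ℝ → EuclideanSpace ℝ (Fin 2) := fun t => ∫ s in (0:ℝ)..t, (w s - c) with hv
  have cwc : Continuous (fun s => w s - c) := cw.sub continuous_const
  have dv : ∀ t, HasDerivAt v (w t - c) t := fun t =>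
    intervalIntegral.integral_hasDerivAt_right (cwc.intervalIntegrable _ _)
      (cwc.stronglyMeasurableAtFilter _ _) cwc.continuousAt
  have v0 : v 0 = 0 := by simp [hv]
  have v1 : v 1 = 0 := by
    simp only [hv]
    rw [intervalIntegral.integral_sub (cw.intervalIntegrable _ _) intervalIntegrable_const]
    simp [← hc]
  have hv1 : ContDiff ℝ 1 v := by
    rw [contDiff_one_iff_deriv]
    refine ⟨fun t => (dv t).differentiableAt, ?_⟩
    have : deriv v = fun t => w t - c := funext fun t => (dv t).deriv
    rw [this]; exact cwc
  have e1 := aux_parts w F v (fun t => w t - c) hF cwc dw dv v0 v1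
  have e2 := aux_parts (fun _ => c) (fun _ => 0) v (fun t => w t - c) continuous_const cwc
    (fun t => hasDerivAt_const t c) dv v0 v1
  rw [h v hv1 v0 v1] at e1
  simp only [inner_zero_left, intervalIntegral.integral_zero] at e2
  have e3 : ∫ t in (0:ℝ)..1, ‖w t - c‖ ^ 2 = 0 := by
    have : ∀ t, ‖w t - c‖ ^ 2 = inner ℝ (w t) (w t - c) - inner ℝ c (w t - c) := fun t => by
      rw [← inner_sub_left, real_inner_self_eq_norm_sq]
    simp only [this]
    rw [intervalIntegral.integral_sub ((cw.inner cwc).intervalIntegrable _ _)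
      ((continuous_const.inner cwc).intervalIntegrable _ _), e1, e2]
    simp
  have e4 : ∀ t ∈ Icc (0:ℝ) 1, w t = c := by
    intro t ht
    by_contra hne
    have := intervalIntegral.integral_lt_integral_of_continuousOn_of_le_of_exists_lt
      (f := fun _ => 0) (g := fun t => ‖w t - c‖ ^ 2) (zero_lt_one (α := ℝ)) continuousOn_const
      (by fun_prop) (fun x _ => by positivity)
      ⟨t, ht, by have := sub_ne_zero.2 hne; positivity⟩
    simp [e3] at this
  refine aux_zero_ext F hF fun t ht => ?_
  have h1 : HasDerivAt w 0 t := (hasDerivAt_const t c).congr_of_eventuallyEq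
    (Filter.eventuallyEq_of_mem (Ioo_mem_nhds ht.1 ht.2) fun s hs => e4 s ⟨hs.1.le, hs.2.le⟩)
  exact (dw t).unique h1

theorem aux_grad (V : EuclideanSpace ℝ (Fin 2) → ℝ) (hV : ContDiff ℝ 1 V) : Continuous (gradient V) := by
  unfold gradient
  exact (LinearIsometryEquiv.continuous _).comp (hV.continuous_fderiv one_ne_zero)

theorem aux_comp (V : EuclideanSpace ℝ (Fin 2) → ℝ) (hV : ContDiff ℝ 1 V) (y : ℝ → EuclideanSpace ℝ (Fin 2)) (y' : EuclideanSpace ℝ (Fin 2)) (t : ℝ)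
    (hy : HasDerivAt y y' t) :
    HasDerivAt (fun s => V (y s)) (inner ℝ (gradient V (y t)) y') t := by
  have h := ((hV.differentiable one_ne_zero) (y t)).hasGradientAt.hasFDerivAt.comp_hasDerivAt t hy
  simpa using! h

/-- A critical point of the Maupertuis functional, after the linear time
reparametrization `s ↦ z (λ s)` with `λ = √((∫ V∘z)/(½∫‖ż‖²))`, is a classical zero-energy
solution of `u'' = ∇V(u)` joining `z₀` to `z₁`. -/
theorem maupertuis_critical_point_is_zero_energy_solution
    (V : EuclideanSpace ℝ (Fin 2) → ℝ)
    (z : ℝ → EuclideanSpace ℝ (Fin 2))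
    (z₀ z₁ : EuclideanSpace ℝ (Fin 2))
    (hV : ContDiff ℝ 1 V)
    (hz : ContDiff ℝ 2 z)
    (hz0 : z 0 = z₀) (hz1 : z 1 = z₁)
    (hVpos : ∀ t ∈ Set.Icc (0:ℝ) 1, 0 < V (z t))
    (hkin : 0 < ∫ t in (0:ℝ)..1, ‖deriv z t‖ ^ 2)
    (hcrit : ∀ v : ℝ → EuclideanSpace ℝ (Fin 2), ContDiff ℝ 1 v → v 0 = 0 → v 1 = 0 →
      deriv (fun ε : ℝ =>
        ((1:ℝ)/2 * ∫ t in (0:ℝ)..1, ‖deriv (fun s => z s + ε • v s) t‖ ^ 2) *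
          (∫ t in (0:ℝ)..1, V (z t + ε • v t))) 0 = 0) :
    let lam := Real.sqrt ((∫ t in (0:ℝ)..1, V (z t)) /
      ((1:ℝ)/2 * ∫ t in (0:ℝ)..1, ‖deriv z t‖ ^ 2))
    let u : ℝ → EuclideanSpace ℝ (Fin 2) := fun s => z (lam * s)
    (∀ s ∈ Set.Icc (0:ℝ) (1/lam),
        deriv (deriv u) s = gradient V (u s) ∧
          (1:ℝ)/2 * ‖deriv u s‖ ^ 2 - V (u s) = 0) ∧
      u 0 = z₀ ∧ u (1/lam) = z₁ := by
  intro lam u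
  set A : ℝ := (1:ℝ)/2 * ∫ t in (0:ℝ)..1, ‖deriv z t‖ ^ 2 with hA
  set B : ℝ := ∫ t in (0:ℝ)..1, V (z t) with hB
  have cz : Continuous z := hz.continuous
  have cV : Continuous V := hV.continuous
  have hz' : ContDiff ℝ 1 (deriv z) := by
    have : ContDiff ℝ (1+1) z := by simpa [one_add_one_eq_two] using hz
    exact (contDiff_succ_iff_deriv.1 this).2.2
  have cz' : Continuous (deriv z) := hz'.continuous
  have cz'' : Continuous (deriv (deriv z)) := (contDiff_one_iff_deriv.1 hz').2
  have dz : ∀ t, HasDerivAt z (deriv z t) t := fun t =>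
    (hz.differentiable two_ne_zero t).hasDerivAt
  have dz' : ∀ t, HasDerivAt (deriv z) (deriv (deriv z) t) t := fun t =>
    (hz'.differentiable one_ne_zero t).hasDerivAt
  have cg := aux_grad V hV
  have Apos : 0 < A := by positivity
  have Bpos : 0 < B := by
    have := intervalIntegral.integral_lt_integral_of_continuousOn_of_le_of_exists_lt
      (f := fun _ => 0) (g := fun t => V (z t)) (zero_lt_one (α := ℝ)) continuousOn_const
      (by fun_prop) (fun x hx => (hVpos x ⟨hx.1.le, hx.2⟩).le) ⟨0, by simp, hVpos 0 (by simp)⟩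
    simpa using this
  have lpos : 0 < lam := Real.sqrt_pos.2 (div_pos Bpos Apos)
  have lsq : lam ^ 2 = B / A := Real.sq_sqrt (div_pos Bpos Apos).le
  -- Euler-Lagrange equation
  have EL : ∀ t ∈ Icc (0:ℝ) 1, A • gradient V (z t) - B • deriv (deriv z) t = 0 := by
    refine aux_fund _ (by fun_prop) fun v hv v0 v1 => ?_
    have cv : Continuous v := hv.continuous
    have cv' : Continuous (deriv v) := (contDiff_one_iff_deriv.1 hv).2
    have dv : ∀ t, HasDerivAt v (deriv v t) t := fun t =>
      (hv.differentiable one_ne_zero t).hasDerivAt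
    have hdd : ∀ ε t : ℝ, deriv (fun s => z s + ε • v s) t = deriv z t + ε • deriv v t :=
      fun ε t => by simpa using! ((dz t).add ((dv t).const_smul ε)).deriv
    have hl : ∀ (a b : EuclideanSpace ℝ (Fin 2)) (ε : ℝ), HasDerivAt (fun ε : ℝ => a + ε • b) b ε := fun a b ε => by
      simpa using! ((hasDerivAt_id ε).smul_const b).const_add a
    have h1 := aux_param (fun ε t => ‖deriv z t + ε • deriv v t‖ ^ 2)
      (fun ε t => 2 * inner ℝ (deriv z t + ε • deriv v t) (deriv v t)) (by fun_prop) (by fun_prop)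
      (fun ε t => (hl _ _ ε).norm_sq)
    have h2 := aux_param (fun ε t => V (z t + ε • v t))
      (fun ε t => inner ℝ (gradient V (z t + ε • v t)) (v t)) (by fun_prop) (by fun_prop)
      (fun ε t => aux_comp V hV _ _ _ (hl _ _ ε))
    have h3 := ((h1.const_mul ((1:ℝ)/2)).mul h2).deriv
    have h4 := hcrit v hv v0 v1
    simp only [hdd] at h4
    have h5 := h3.symm.trans h4
    simp only [zero_smul, add_zero, intervalIntegral.integral_const_mul] at h5
    rw [← hA, ← hB, aux_parts _ _ _ _ cz'' cv' dz' dv v0 v1] at h5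
    simp only [inner_sub_left, real_inner_smul_left]
    rw [intervalIntegral.integral_sub (Continuous.intervalIntegrable (by fun_prop) _ _)
      (Continuous.intervalIntegrable (by fun_prop) _ _), intervalIntegral.integral_const_mul,
      intervalIntegral.integral_const_mul]
    linarith
  have EL2 : ∀ t ∈ Icc (0:ℝ) 1, lam ^ 2 • deriv (deriv z) t = gradient V (z t) := by
    intro t ht
    have h := sub_eq_zero.1 (EL t ht)
    rw [lsq, div_eq_inv_mul, mul_smul, ← h, smul_smul, inv_mul_cancel₀ Apos.ne', one_smul]
  -- energy
  set En : ℝ → ℝ := fun t => (1:ℝ)/2 * (lam ^ 2 * ‖deriv z t‖ ^ 2) - V (z t) with hEn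
  have dE : ∀ t ∈ Icc (0:ℝ) 1, HasDerivAt En 0 t := by
    intro t ht
    have h := ((((dz' t).norm_sq).const_mul (lam ^ 2)).const_mul ((1:ℝ)/2)).sub
      (aux_comp V hV z _ t (dz t))
    refine h.congr_deriv ?_
    rw [← EL2 t ht, real_inner_smul_left, real_inner_comm (deriv z t)]
    ring
  have hconst : ∀ t ∈ Icc (0:ℝ) 1, En t = En 0 :=
    constant_of_has_deriv_right_zero (fun t ht => (dE t ht).continuousAt.continuousWithinAt)
      (fun t ht => (dE t ⟨ht.1, ht.2.le⟩).hasDerivWithinAt)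
  have hint : ∫ t in (0:ℝ)..1, En t = 0 := by
    simp only [hEn]
    rw [intervalIntegral.integral_sub (Continuous.intervalIntegrable (by fun_prop) _ _)
      (Continuous.intervalIntegrable (by fun_prop) _ _), intervalIntegral.integral_const_mul,
      intervalIntegral.integral_const_mul, ← hB, mul_left_comm, ← hA, lsq]
    field_simp
    simp
  have hE0 : En 0 = 0 := by
    rw [intervalIntegral.integral_congr (g := fun _ => En 0)
      (fun t ht => hconst t (by rwa [uIcc_of_le zero_le_one] at ht))] at hint
    simpa using hint
  have du : ∀ s, HasDerivAt u (lam • deriv z (lam * s)) s := fun s => by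
    have h := (dz (lam * s)).scomp s ((hasDerivAt_id s).const_mul lam)
    simpa using! h
  have du' : deriv u = fun s => lam • deriv z (lam * s) := funext fun s => (du s).deriv
  have ddu : ∀ s, deriv (deriv u) s = lam ^ 2 • deriv (deriv z) (lam * s) := fun s => by
    have h := ((dz' (lam * s)).scomp s ((hasDerivAt_id s).const_mul lam)).const_smul lam
    rw [du', pow_two, mul_smul]
    simpa using! h.deriv
  refine ⟨fun s hs => ?_, ?_, ?_⟩
  · have hs' : lam * s ∈ Icc (0:ℝ) 1 := by
      refine ⟨mul_nonneg lpos.le hs.1, ?_⟩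
      have := hs.2
      rwa [le_div_iff₀ lpos, mul_comm] at this
    refine ⟨by rw [ddu, EL2 _ hs'], ?_⟩
    have h := (hconst _ hs').trans hE0
    rw [(du s).deriv, norm_smul, mul_pow, Real.norm_eq_abs, sq_abs]
    exact h
  · simp [u, hz0]
  · simp only [u]
    rw [mul_one_div_cancel lpos.ne', hz1]
end
end

section
/- Let 𝓔, h, μ > 0 and set Ω = √(2(𝓔+h)). Let T > 0 and let w : [0,T] → ℂ be of class C² with w(τ) ≠ 0 for all τ, satisfying w''(τ) = Ω²·w(τ) and ½|w'(τ)|² − (Ω²/2)|w(τ)|² = μ on [0,T]. Define σ : [0,T] → ℝ by σ(τ) = ∫₀^τ 2|w(u)|² du and S = σ(T). Then σ is a strictly increasing bijection from [0,T] onto [0,S], and the function z : [0,S] → ℂ determined by z(σ(τ)) = w(τ)² is twice differentiable and satisfies the Kepler equation z''(s) = −μ·z(s)/|z(s)|³ together with the energy relation ½|z'(s)|² − (𝓔+h) − μ/|z(s)| = 0, for all s ∈ [0,S]. -/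
noncomputable section

/-- A global time change with continuous speed bounded below has a differentiable inverse. -/
lemma time_change_inverse (ρ : ℝ → ℝ) (hρ : Continuous ρ) (c : ℝ) (hc : 0 < c)
    (hcρ : ∀ x, c ≤ ρ x) :
    ∃ g : ℝ → ℝ, StrictMono (fun t => ∫ u in (0:ℝ)..t, ρ u) ∧
      (∀ t, g (∫ u in (0:ℝ)..t, ρ u) = t) ∧ (∀ s, ∫ u in (0:ℝ)..(g s), ρ u = s) ∧
      ∀ s, HasDerivAt g (ρ (g s))⁻¹ s := by
  set F : ℝ → ℝ := fun t => ∫ u in (0:ℝ)..t, ρ u with hF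
  have hd : ∀ t, HasDerivAt F (ρ t) t := fun t => hρ.integral_hasStrictDerivAt 0 t |>.hasDerivAt
  have hmono : StrictMono F := strictMono_of_deriv_pos (fun x => by
    rw [(hd x).deriv]; exact hc.trans_le (hcρ x))
  have hcont : Continuous F := continuous_iff_continuousAt.2 fun t => (hd t).continuousAt
  have hd2 : ∀ t, HasDerivAt (fun t => F t - c * t) (ρ t - c) t := fun t => by
    simpa using (hd t).fun_sub ((hasDerivAt_id t).const_mul c)
  have hm2 : Monotone (fun t => F t - c * t) := monotone_of_deriv_nonneg
    (fun t => (hd2 t).differentiableAt) (fun t => by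
      rw [(hd2 t).deriv]; linarith [hcρ t])
  have hF0 : F 0 = 0 := by simp [hF]
  have htop : Filter.Tendsto F Filter.atTop Filter.atTop := by
    refine Filter.tendsto_atTop_mono' _ ?_ (Filter.tendsto_id.const_mul_atTop hc)
    filter_upwards [Filter.eventually_ge_atTop 0] with t ht
    have := hm2 ht
    simp only [hF0, id] at this ⊢
    linarith
  have hbot : Filter.Tendsto F Filter.atBot Filter.atBot := by
    refine Filter.tendsto_atBot_mono' _ ?_ (Filter.tendsto_id.const_mul_atBot hc)
    filter_upwards [Filter.eventually_le_atBot 0] with t ht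
    have := hm2 ht
    simp only [hF0, id] at this ⊢
    linarith
  have hsurj := hcont.surjective htop hbot
  let e := hmono.orderIsoOfSurjective F hsurj
  have he : ∀ t, e t = F t := fun t => rfl
  have h1 : ∀ s, F (e.symm s) = s := fun s => by rw [← he]; simp
  refine ⟨e.symm, hmono, fun t => ?_, h1, fun s => ?_⟩
  · change e.symm (F t) = t
    rw [← he]; simp
  · exact HasDerivAt.of_local_left_inverse e.symm.continuous.continuousAt (hd _)
      (hc.trans_le (hcρ _)).ne' (Filter.Eventually.of_forall h1)

/-- Levi-Civita regularization: a solution of the harmonic repulsor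
`w'' = Ω² w` with energy `½|w'|² − (Ω²/2)|w|² = μ` and `Ω = √(2(𝓔+h))`, transformed by the
complex square `z = w²` and the time change `σ(τ) = ∫₀^τ 2|w|²`, yields a solution of the
Kepler problem `z'' = −μ z/|z|³` with energy relation `½|z'|² − (𝓔+h) − μ/|z| = 0`. -/
theorem leviCivita_conjugates_repulsor_to_kepler
    (𝓔 h μ T : ℝ) (h𝓔 : 0 < 𝓔) (hh : 0 < h) (hμ : 0 < μ) (hT : 0 < T)
    (Ω : ℝ) (hΩ : Ω = Real.sqrt (2 * (𝓔 + h)))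
    (w : ℝ → ℂ) (hw : ContDiff ℝ 2 w)
    (hwne : ∀ τ ∈ Set.Icc (0:ℝ) T, w τ ≠ 0)
    (hode : ∀ τ ∈ Set.Icc (0:ℝ) T, deriv (deriv w) τ = (Ω^2 : ℂ) * w τ)
    (henergy : ∀ τ ∈ Set.Icc (0:ℝ) T,
      (1:ℝ)/2 * ‖deriv w τ‖ ^ 2 - Ω^2/2 * ‖w τ‖ ^ 2 = μ) :
    let σ : ℝ → ℝ := fun τ => ∫ u in (0:ℝ)..τ, 2 * ‖w u‖ ^ 2
    let S := σ T
    StrictMonoOn σ (Set.Icc 0 T) ∧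
    Set.BijOn σ (Set.Icc 0 T) (Set.Icc 0 S) ∧
    ∃ z : ℝ → ℂ,
      (∀ τ ∈ Set.Icc (0:ℝ) T, z (σ τ) = (w τ) ^ 2) ∧
      ∀ s ∈ Set.Icc (0:ℝ) S,
        DifferentiableAt ℝ z s ∧ DifferentiableAt ℝ (deriv z) s ∧
        deriv (deriv z) s = -((μ / ‖z s‖ ^ 3 : ℝ) : ℂ) * z s ∧
        (1:ℝ)/2 * ‖deriv z s‖ ^ 2 - (𝓔 + h) - μ / ‖z s‖ = 0 := by
  intro σ S
  have hwc : Continuous w := hw.continuous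
  have hw1 : ∀ t, HasDerivAt w (deriv w t) t := fun t =>
    (hw.differentiable (by norm_num) t).hasDerivAt
  have hw' : ContDiff ℝ 1 (deriv w) := by
    have : ContDiff ℝ (1 + 1) w := by simpa [one_add_one_eq_two] using hw
    exact (contDiff_succ_iff_deriv.1 this).2.2
  have hw2 : ∀ t, HasDerivAt (deriv w) (deriv (deriv w) t) t := fun t =>
    (hw'.differentiable (by norm_num) t).hasDerivAt
  have hΩ2 : Ω ^ 2 = 2 * (𝓔 + h) := by rw [hΩ, Real.sq_sqrt (by positivity)]
  have hrc : Continuous (fun u => 2 * ‖w u‖ ^ 2) := by fun_prop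
  obtain ⟨t0, ht0, hmin⟩ := isCompact_Icc.exists_isMinOn (Set.nonempty_Icc.2 hT.le)
    hrc.continuousOn
  have hpos : 0 < 2 * ‖w t0‖ ^ 2 := by
    have := norm_pos_iff.2 (hwne t0 ht0)
    positivity
  obtain ⟨c, hc, hc2⟩ := exists_between hpos
  have hlt : ∀ t ∈ Set.Icc 0 T, c < 2 * ‖w t‖ ^ 2 := fun t ht => hc2.trans_le (hmin ht)
  set ρ : ℝ → ℝ := fun u => max c (2 * ‖w u‖ ^ 2) with hρ
  obtain ⟨g, hmono, hg1, hg2, hgd⟩ := time_change_inverse ρ (by fun_prop) c hc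
    (fun x => le_max_left _ _)
  have hσ : ∀ t ∈ Set.Icc 0 T, ∫ u in (0:ℝ)..t, ρ u = σ t := by
    intro t ht
    refine intervalIntegral.integral_congr fun u hu => ?_
    rw [Set.uIcc_of_le ht.1] at hu
    exact max_eq_right (hlt u ⟨hu.1, hu.2.trans ht.2⟩).le
  have h0T : (0:ℝ) ∈ Set.Icc 0 T := ⟨le_rfl, hT.le⟩
  have hTT : T ∈ Set.Icc 0 T := ⟨hT.le, le_rfl⟩
  have hσ0 : σ 0 = 0 := by simp [σ]
  have hσm : StrictMonoOn σ (Set.Icc 0 T) := by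
    intro a ha b hb hab
    rw [← hσ a ha, ← hσ b hb]
    exact hmono hab
  have hgmem : ∀ s ∈ Set.Icc 0 S, g s ∈ Set.Icc 0 T := by
    intro s hs
    constructor
    · refine hmono.le_iff_le.1 ?_
      change (∫ u in (0:ℝ)..0, ρ u) ≤ ∫ u in (0:ℝ)..(g s), ρ u
      rw [hg2]; simpa using hs.1
    · refine hmono.le_iff_le.1 ?_
      change (∫ u in (0:ℝ)..(g s), ρ u) ≤ ∫ u in (0:ℝ)..T, ρ u
      rw [hg2, hσ T hTT]; exact hs.2
  refine ⟨hσm, ⟨?_, hσm.injOn, ?_⟩, fun s => w (g s) ^ 2, ?_, ?_⟩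
  · intro t ht
    refine ⟨?_, hσm.monotoneOn ht hTT ht.2⟩
    rw [← hσ0]
    exact hσm.monotoneOn h0T ht ht.1
  · intro s hs
    exact ⟨g s, hgmem s hs, by rw [← hσ _ (hgmem s hs), hg2]⟩
  · intro t ht
    simp only
    rw [← hσ t ht, hg1]
  intro s hs
  have hgs := hgmem s hs
  have hwg : ∀ r, HasDerivAt (fun r => w (g r)) (((ρ (g r))⁻¹ : ℝ) • deriv w (g r)) r :=
    fun r => (hw1 (g r)).scomp r (hgd r)
  have hwg' : ∀ r, HasDerivAt (fun r => deriv w (g r))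
      (((ρ (g r))⁻¹ : ℝ) • deriv (deriv w) (g r)) r :=
    fun r => (hw2 (g r)).scomp r (hgd r)
  have hz : ∀ r, HasDerivAt (fun r => w (g r) ^ 2)
      (2 * w (g r) * (((ρ (g r))⁻¹ : ℝ) • deriv w (g r))) r := fun r => by
    simpa using (hwg r).fun_pow 2
  have hgc : Continuous g := continuous_iff_continuousAt.2 fun t => (hgd t).continuousAt
  have hstar : ∀ r, c < 2 * ‖w (g r)‖ ^ 2 →
      deriv (fun r => w (g r) ^ 2) r = deriv w (g r) / star (w (g r)) := by
    intro r hr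
    have hne : w (g r) ≠ 0 := by
      intro h0
      rw [h0] at hr
      norm_num at hr
      linarith
    have hne' : star (w (g r)) ≠ 0 := star_ne_zero.2 hne
    have hn : ((‖w (g r)‖ : ℂ)) ^ 2 = w (g r) * star (w (g r)) := (Complex.mul_conj' _).symm
    rw [(hz r).deriv, hρ]
    simp only [max_eq_right hr.le, Complex.real_smul]
    push_cast
    rw [hn]
    field_simp
  have hev : deriv (fun r => w (g r) ^ 2) =ᶠ[nhds s]
      fun r => deriv w (g r) / star (w (g r)) := by
    have : ∀ᶠ r in nhds s, c < 2 * ‖w (g r)‖ ^ 2 :=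
      (hrc.comp hgc).continuousAt.eventually (lt_mem_nhds (hlt _ hgs))
    filter_upwards [this] with r hr using hstar r hr
  have hne : w (g s) ≠ 0 := hwne _ hgs
  have hne' : star (w (g s)) ≠ 0 := star_ne_zero.2 hne
  have hn : ((‖w (g s)‖ : ℂ)) ^ 2 = w (g s) * star (w (g s)) := (Complex.mul_conj' _).symm
  have hn' : ((‖deriv w (g s)‖ : ℂ)) ^ 2 = deriv w (g s) * star (deriv w (g s)) :=
    (Complex.mul_conj' _).symm
  have hnpos : 0 < ‖w (g s)‖ := norm_pos_iff.2 hne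
  have hE := henergy _ hgs
  have hdd := ((hwg' s).div (hwg s).star hne').congr_of_eventuallyEq hev
  refine ⟨(hz s).differentiableAt, hdd.differentiableAt, ?_, ?_⟩
  · rw [hdd.deriv, hode _ hgs]
    have hEc : (μ : ℂ) = 1 / 2 * (deriv w (g s) * star (deriv w (g s)))
        - Ω ^ 2 / 2 * (w (g s) * star (w (g s))) := by
      rw [← hn, ← hn', ← hE]; push_cast; ring
    have hρs : ρ (g s) = 2 * ‖w (g s)‖ ^ 2 := max_eq_right (hlt _ hgs).le
    have h6 : ((‖w (g s) ^ 2‖ ^ 3 : ℝ) : ℂ) = (w (g s) * star (w (g s))) ^ 3 := by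
      rw [← hn, norm_pow]; push_cast; ring
    rw [Complex.ofReal_div, h6, hEc, hρs]
    rw [star_smul, star_trivial (R := ℝ)]
    simp only [Complex.real_smul]
    push_cast
    rw [hn]
    generalize star (w (g s)) = a at *
    generalize star (deriv w (g s)) = b at *
    field_simp
    ring
  · rw [hstar s (hlt _ hgs), norm_div, norm_star, norm_pow]
    have : 𝓔 + h = Ω ^ 2 / 2 := by rw [hΩ2]; ring
    rw [this, ← hE]
    field_simp
    ring
end
end

section
/- Let E, Ω, ρ > 0 and set T = (1/Ω)·arcsinh(Ω√ρ/√(2E)). Define g₀ : ℝ → ℝ by g₀(τ) = sinh(Ω(T−τ))/sinh(2ΩT). Then g₀''(τ) = Ω²·g₀(τ) for all τ, g₀(−T) = 1, g₀(T) = 0, g₀'(−T) = −(E + Ω²ρ)/(√ρ·√(2E + Ω²ρ)), and g₀'(T) = −E/(√ρ·√(2E + Ω²ρ)). -/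
noncomputable section

/-- The Jacobi field `g₀(τ) = sinh(Ω(T−τ))/sinh(2ΩT)` along the regularized
homotetic inner arc: it solves `g'' = Ω²g` with `g₀(−T) = 1`, `g₀(T) = 0`, and its boundary
derivatives are `−(E + Ω²ρ)/(√ρ√(2E + Ω²ρ))` and `−E/(√ρ√(2E + Ω²ρ))`. -/
theorem inner_jacobi_field
    (E Ω ρ : ℝ) (hE : 0 < E) (hΩ : 0 < Ω) (hρ : 0 < ρ) :
    let T := (1/Ω) * Real.arsinh (Ω * Real.sqrt ρ / Real.sqrt (2 * E))
    let g₀ : ℝ → ℝ := fun τ => Real.sinh (Ω * (T - τ)) / Real.sinh (2 * Ω * T)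
    (∀ τ : ℝ, deriv (deriv g₀) τ = Ω ^ 2 * g₀ τ) ∧
    g₀ (-T) = 1 ∧ g₀ T = 0 ∧
    deriv g₀ (-T) = -((E + Ω ^ 2 * ρ) / (Real.sqrt ρ * Real.sqrt (2 * E + Ω ^ 2 * ρ))) ∧
    deriv g₀ T = -(E / (Real.sqrt ρ * Real.sqrt (2 * E + Ω ^ 2 * ρ))) := by
  intro T g₀
  have hr : 0 < Real.sqrt ρ := Real.sqrt_pos.2 hρ
  have hs : 0 < Real.sqrt (2 * E) := Real.sqrt_pos.2 (by positivity)
  have hq : 0 < Real.sqrt (2 * E + Ω ^ 2 * ρ) := Real.sqrt_pos.2 (by positivity)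
  have hr2 : Real.sqrt ρ ^ 2 = ρ := Real.sq_sqrt hρ.le
  have hs2 : Real.sqrt (2 * E) ^ 2 = 2 * E := Real.sq_sqrt (by positivity)
  have hq2 : Real.sqrt (2 * E + Ω ^ 2 * ρ) ^ 2 = 2 * E + Ω ^ 2 * ρ :=
    Real.sq_sqrt (by positivity)
  have hΩT : Ω * T = Real.arsinh (Ω * Real.sqrt ρ / Real.sqrt (2 * E)) := by
    simp only [T]
    field_simp
  have hsinh : Real.sinh (Ω * T) = Ω * Real.sqrt ρ / Real.sqrt (2 * E) := by
    rw [hΩT, Real.sinh_arsinh]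
  have hcosh : Real.cosh (Ω * T) = Real.sqrt (2 * E + Ω ^ 2 * ρ) / Real.sqrt (2 * E) := by
    have h1 := Real.cosh_sq (Ω * T)
    have h2 := Real.cosh_pos (Ω * T)
    have h3 : Real.cosh (Ω * T) ^ 2
        = (Real.sqrt (2 * E + Ω ^ 2 * ρ) / Real.sqrt (2 * E)) ^ 2 := by
      rw [h1, hsinh, div_pow, div_pow, mul_pow, hr2, hs2, hq2]
      field_simp
      ring
    exact (sq_eq_sq₀ h2.le (by positivity)).1 h3
  have hS : Real.sinh (2 * Ω * T)
      = Ω * Real.sqrt ρ * Real.sqrt (2 * E + Ω ^ 2 * ρ) / E := by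
    rw [mul_assoc, Real.sinh_two_mul, hsinh, hcosh]
    have : 2 * (Ω * Real.sqrt ρ / Real.sqrt (2 * E))
        * (Real.sqrt (2 * E + Ω ^ 2 * ρ) / Real.sqrt (2 * E))
        = 2 * Ω * Real.sqrt ρ * Real.sqrt (2 * E + Ω ^ 2 * ρ) / Real.sqrt (2 * E) ^ 2 := by
      field_simp
    rw [this, hs2]
    field_simp
  have hC : Real.cosh (2 * Ω * T) = (E + Ω ^ 2 * ρ) / E := by
    rw [mul_assoc, Real.cosh_two_mul, hsinh, hcosh, div_pow, div_pow, mul_pow, hr2, hs2, hq2]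
    field_simp
    ring
  have hSpos : 0 < Real.sinh (2 * Ω * T) := by
    rw [hS]
    positivity
  have hlin : ∀ τ : ℝ, HasDerivAt (fun τ : ℝ => Ω * (T - τ)) (-Ω) τ := by
    intro τ
    have h := ((hasDerivAt_id τ).const_sub T).const_mul Ω
    simpa using h
  have hd : deriv g₀ = fun τ => Real.cosh (Ω * (T - τ)) * (-Ω) / Real.sinh (2 * Ω * T) := by
    funext τ
    exact ((hlin τ).sinh.div_const _).deriv
  refine ⟨?_, ?_, ?_, ?_, ?_⟩
  · intro τ
    rw [hd]
    have h := (((hlin τ).cosh.mul_const (-Ω)).div_const (Real.sinh (2 * Ω * T))).deriv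
    rw [h]
    simp only [g₀]
    ring
  · have h : Ω * (T - -T) = 2 * Ω * T := by ring
    simp only [g₀]
    rw [h, div_self hSpos.ne']
  · simp [g₀]
  · have h : Ω * (T - -T) = 2 * Ω * T := by ring
    rw [hd]
    simp only []
    rw [h, hC, hS]
    field_simp
  · rw [hd]
    simp only [sub_self, mul_zero, Real.cosh_zero]
    rw [hS]
    field_simp
end
end

section
/- Let 𝓔, μ, ρ > 0, let vE > 0 and vI > 0, and let k ∈ ℝ. Define E₀ = 𝓔/(2ρ√vE), ε_E = (ρk − 1)·√vE/ρ, I₀ = −μ/(4ρ²√vI), ε_I = −(ρk − 1)·√vI/ρ, and let A₁₁ = 1 + (2ε_E + ε_I)/I₀ + ε_E(ε_E + ε_I + I₀)/(E₀I₀), A₁₂ = √vE·(1/I₀ + 1/E₀) + √vE·(ε_E + ε_I)/(E₀I₀), A₂₁ = (2ε_E(ε_I + I₀) + ε_I(ε_I + 2I₀))/(I₀√vE) + ε_E(ε_E(ε_I + I₀) + ε_I(ε_I + 2I₀))/(E₀I₀√vE), A₂₂ = 1 + ε_E/E₀ + ε_I(2I₀ + ε_I + E₀ + ε_E)/(E₀I₀).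 Then (A₁₁ + A₂₂)² − 4 = A·B·C·D, where A = (16/(𝓔²μ²))·(√vI − √vE)·(ρk − 1), B = 𝓔 − (ρk − 1)·(√vI − √vE)·√vE, C = −μ√vE + 2ρ·B·√vI, and D = μ + 2ρ·(ρk − 1)·√vI·(√vI − √vE). -/
noncomputable section

/-- The discriminant `(tr DF)² − 4` of the characteristic polynomial of the
Jacobian of the first-return map at a homotetic fixed point factors as the product
`Δ = A·B·C·D` of Theorem 1. -/
theorem return_map_discriminant_factorization
    (𝓔 μ ρ vE vI k : ℝ)
    (h𝓔 : 0 < 𝓔) (hμ : 0 < μ) (hρ : 0 < ρ) (hvE : 0 < vE) (hvI : 0 < vI) :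
    let E₀ := 𝓔 / (2 * ρ * Real.sqrt vE)
    let εE := (ρ * k - 1) * Real.sqrt vE / ρ
    let I₀ := -μ / (4 * ρ ^ 2 * Real.sqrt vI)
    let εI := -(ρ * k - 1) * Real.sqrt vI / ρ
    let A11 := 1 + (2*εE + εI)/I₀ + εE*(εE + εI + I₀)/(E₀*I₀)
    let A12 := Real.sqrt vE * (1/I₀ + 1/E₀) + Real.sqrt vE * (εE + εI)/(E₀*I₀)
    let A21 := (2*εE*(εI + I₀) + εI*(εI + 2*I₀))/(I₀ * Real.sqrt vE)
      + εE*(εE*(εI + I₀) + εI*(εI + 2*I₀))/(E₀*I₀*Real.sqrt vE)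
    let A22 := 1 + εE/E₀ + εI*(2*I₀ + εI + E₀ + εE)/(E₀*I₀)
    let A := 16/(𝓔^2*μ^2) * (Real.sqrt vI - Real.sqrt vE) * (ρ*k - 1)
    let B := 𝓔 - (ρ*k - 1) * (Real.sqrt vI - Real.sqrt vE) * Real.sqrt vE
    let C := -μ * Real.sqrt vE + 2*ρ*B*Real.sqrt vI
    let D := μ + 2*ρ*(ρ*k - 1) * Real.sqrt vI * (Real.sqrt vI - Real.sqrt vE)
    (A11 + A22) ^ 2 - 4 = A * B * C * D := by
  intro E₀ εE I₀ εI A11 A12 A21 A22 A B C D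
  have ha : Real.sqrt vE ≠ 0 := (Real.sqrt_pos.mpr hvE).ne'
  have hb : Real.sqrt vI ≠ 0 := (Real.sqrt_pos.mpr hvI).ne'
  have hE : E₀ ≠ 0 := by simp only [E₀]; positivity
  have hI : I₀ ≠ 0 := div_ne_zero (neg_ne_zero.mpr hμ.ne') (by positivity)
  have h1 : (A11 + A22) ^ 2 - 4 = (εE + εI) * (2*E₀ + 2*I₀ + (εE + εI))
      * ((2*E₀ + (εE + εI)) * (2*I₀ + (εE + εI))) / (E₀*I₀)^2 := by
    simp only [A11, A22]
    clear_value E₀ I₀ εE εI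
    field_simp
    ring
  rw [h1]
  have hs : εE + εI = -((ρ*k - 1) * (Real.sqrt vI - Real.sqrt vE)) / ρ := by
    simp only [εE, εI]
    field_simp
    ring
  have h2 : 2*E₀ + (εE + εI) = B / (ρ * Real.sqrt vE) := by
    rw [hs]; simp only [E₀, B]
    field_simp
    ring
  have h3 : 2*I₀ + (εE + εI) = -D / (2 * ρ^2 * Real.sqrt vI) := by
    rw [hs]; simp only [I₀, D]
    field_simp
    ring
  have h4 : 2*E₀ + 2*I₀ + (εE + εI) = C / (2 * ρ^2 * Real.sqrt vE * Real.sqrt vI) := by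
    have : 2*E₀ + 2*I₀ + (εE + εI) = (2*E₀ + (εE + εI)) + 2*I₀ := by ring
    rw [this, h2]; simp only [I₀, C]
    clear_value B
    field_simp
    ring
  rw [h4, h2, h3, hs]
  simp only [A, E₀, I₀]
  clear_value B C D
  field_simp
  ring
end
end

section
/- Fix 𝓔, h, μ, ω > 0 with 2𝓔 > ω², and regard Δ⁰ and Δ¹ as functions of the eccentricity e ∈ (0,1). Then lim_{e→0⁺} Δ⁰(e)/e² = (16/(𝓔μ))·(√(𝓔+h+μ) − √(𝓔−ω²/2))·(2𝓔·√(𝓔+h+μ) − μ·√(𝓔−ω²/2)) and lim_{e→0⁺} Δ¹(e)/e² = −(16/(𝓔μ))·(√(𝓔+h+μ) − √(𝓔−ω²/2))·(2𝓔·√(𝓔+h+μ) − μ·√(𝓔−ω²/2)); in particular the two limits are opposite to each other. -/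
/-- Stability discriminant `Δ⁰ = A⁰B⁰C⁰D⁰` of the horizontal homotetic collision-ejection
orbit of the elliptic refraction billiard, with `V_E⁰ = 𝓔 − ω²/2`, `V_I⁰ = 𝓔 + h + μ`. -/
noncomputable def Delta0 (𝓔 h μ ω e : ℝ) : ℝ :=
  let vE := 𝓔 - ω ^ 2 / 2
  let vI := 𝓔 + h + μ
  let A := -(16 / (𝓔 ^ 2 * μ ^ 2)) * (e ^ 2 / (1 - e ^ 2)) * (Real.sqrt vE - Real.sqrt vI)
  let B := μ + 2 * e ^ 2 / (1 - e ^ 2) * Real.sqrt vI * (Real.sqrt vI - Real.sqrt vE)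
  let C := 𝓔 + e ^ 2 / (1 - e ^ 2) * Real.sqrt vE * (Real.sqrt vE - Real.sqrt vI)
  let D := -μ * Real.sqrt vE + 2 * Real.sqrt vI * C
  A * B * C * D

/-- Stability discriminant `Δ¹ = A¹B¹C¹D¹` of the vertical homotetic collision-ejection
orbit of the elliptic refraction billiard, with `b = √(1−e²)`, `V_E¹ = 𝓔 − ω²b²/2`,
`V_I¹ = 𝓔 + h + μ/b`. -/
noncomputable def Delta1 (𝓔 h μ ω e : ℝ) : ℝ :=
  let b := Real.sqrt (1 - e ^ 2)
  let vE := 𝓔 - ω ^ 2 * b ^ 2 / 2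
  let vI := 𝓔 + h + μ / b
  let A := 16 * e ^ 2 / (𝓔 ^ 2 * μ ^ 2) * (Real.sqrt vE - Real.sqrt vI)
  let B := μ - 2 * e ^ 2 * b * Real.sqrt vI * (Real.sqrt vI - Real.sqrt vE)
  let C := 𝓔 - e ^ 2 * Real.sqrt vE * (Real.sqrt vE - Real.sqrt vI)
  let D := -μ * Real.sqrt vE + 2 * b * Real.sqrt vI * C
  A * B * C * D

/-- Small-eccentricity asymptotics: `Δ⁰(e)/e²` and `Δ¹(e)/e²` converge, as
`e → 0⁺`, to opposite limits `±(16/(𝓔μ))·(√(𝓔+h+μ) − √(𝓔−ω²/2))·(2𝓔√(𝓔+h+μ) − μ√(𝓔−ω²/2))`. -/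
theorem delta_small_eccentricity_asymptotics
    (𝓔 h μ ω : ℝ) (h𝓔 : 0 < 𝓔) (hh : 0 < h) (hμ : 0 < μ) (hω : 0 < ω)
    (hHill : ω ^ 2 < 2 * 𝓔) :
    let L := 16 / (𝓔 * μ) * (Real.sqrt (𝓔 + h + μ) - Real.sqrt (𝓔 - ω ^ 2 / 2)) *
      (2 * 𝓔 * Real.sqrt (𝓔 + h + μ) - μ * Real.sqrt (𝓔 - ω ^ 2 / 2))
    Filter.Tendsto (fun e => Delta0 𝓔 h μ ω e / e ^ 2)
        (nhdsWithin 0 (Set.Ioi 0)) (nhds L) ∧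
      Filter.Tendsto (fun e => Delta1 𝓔 h μ ω e / e ^ 2)
        (nhdsWithin 0 (Set.Ioi 0)) (nhds (-L)) := by
  intro L
  have hb : ContinuousAt (fun e : ℝ => Real.sqrt (1 - e ^ 2)) 0 := by fun_prop
  have hne : (1 : ℝ) - 0 ^ 2 ≠ 0 := by norm_num
  have hsne : Real.sqrt ((1 : ℝ) - 0 ^ 2) ≠ 0 := by norm_num
  have key : ∀ F G : ℝ → ℝ, ∀ l : ℝ, ContinuousAt G 0 → G 0 = l →
      (∀ e, F e = e ^ 2 * G e) →
      Filter.Tendsto (fun e => F e / e ^ 2) (nhdsWithin 0 (Set.Ioi 0)) (nhds l) := by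
    intro F G l hG hl hF
    have h1 : Filter.Tendsto G (nhdsWithin 0 (Set.Ioi 0)) (nhds l) := by
      rw [← hl]
      exact hG.tendsto.mono_left nhdsWithin_le_nhds
    refine h1.congr' ?_
    filter_upwards [self_mem_nhdsWithin] with e he
    have he' : e ≠ 0 := ne_of_gt he
    rw [hF e]
    field_simp
  constructor
  · refine key _ (fun e =>
      let vE := 𝓔 - ω ^ 2 / 2
      let vI := 𝓔 + h + μ
      let A := -(16 / (𝓔 ^ 2 * μ ^ 2)) * (1 / (1 - e ^ 2)) * (Real.sqrt vE - Real.sqrt vI)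
      let B := μ + 2 * e ^ 2 / (1 - e ^ 2) * Real.sqrt vI * (Real.sqrt vI - Real.sqrt vE)
      let C := 𝓔 + e ^ 2 / (1 - e ^ 2) * Real.sqrt vE * (Real.sqrt vE - Real.sqrt vI)
      let D := -μ * Real.sqrt vE + 2 * Real.sqrt vI * C
      A * B * C * D) _ ?_ ?_ ?_
    · dsimp only
      fun_prop (disch := assumption)
    · simp [L]
      field_simp
      ring
    · intro e
      simp only [Delta0]
      ring
  · refine key _ (fun e =>
      let b := Real.sqrt (1 - e ^ 2)
      let vE := 𝓔 - ω ^ 2 * b ^ 2 / 2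
      let vI := 𝓔 + h + μ / b
      let A := 16 / (𝓔 ^ 2 * μ ^ 2) * (Real.sqrt vE - Real.sqrt vI)
      let B := μ - 2 * e ^ 2 * b * Real.sqrt vI * (Real.sqrt vI - Real.sqrt vE)
      let C := 𝓔 - e ^ 2 * Real.sqrt vE * (Real.sqrt vE - Real.sqrt vI)
      let D := -μ * Real.sqrt vE + 2 * b * Real.sqrt vI * C
      A * B * C * D) _ ?_ ?_ ?_
    · dsimp only
      fun_prop (disch := assumption)
    · simp [L]
      field_simp
      ring
    · intro e
      simp only [Delta1]
      ring
end

section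
/- Fix 𝓔, h, μ, ω > 0 with 2𝓔 > ω². If √(𝓔+h+μ)/μ < √(2𝓔−ω²)/(2√2·𝓔), then there exists ē ∈ (0,1) such that for every eccentricity e ∈ (0,ē) one has Δ⁰(e) < 0 and Δ¹(e) > 0 (the horizontal homotetic orbit is linearly stable and the vertical one linearly unstable). If instead √(𝓔+h+μ)/μ > √(2𝓔−ω²)/(2√2·𝓔), then there exists ē ∈ (0,1) such that for every e ∈ (0,ē) one has Δ⁰(e) > 0 and Δ¹(e) < 0. -/
/-- `Delta0` divided by `e ^ 2`. -/
noncomputable def F0aux (𝓔 h μ ω e : ℝ) : ℝ :=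
  (-(16 / (𝓔 ^ 2 * μ ^ 2)) * (1 / (1 - e ^ 2)) *
      (Real.sqrt (𝓔 - ω ^ 2 / 2) - Real.sqrt (𝓔 + h + μ))) *
    (μ + 2 * e ^ 2 / (1 - e ^ 2) * Real.sqrt (𝓔 + h + μ) *
      (Real.sqrt (𝓔 + h + μ) - Real.sqrt (𝓔 - ω ^ 2 / 2))) *
    (𝓔 + e ^ 2 / (1 - e ^ 2) * Real.sqrt (𝓔 - ω ^ 2 / 2) *
      (Real.sqrt (𝓔 - ω ^ 2 / 2) - Real.sqrt (𝓔 + h + μ))) *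
    (-μ * Real.sqrt (𝓔 - ω ^ 2 / 2) + 2 * Real.sqrt (𝓔 + h + μ) *
      (𝓔 + e ^ 2 / (1 - e ^ 2) * Real.sqrt (𝓔 - ω ^ 2 / 2) *
      (Real.sqrt (𝓔 - ω ^ 2 / 2) - Real.sqrt (𝓔 + h + μ))))

/-- `Delta1` divided by `e ^ 2`, with `b` as a separate variable. -/
noncomputable def F1aux (𝓔 h μ ω e b : ℝ) : ℝ :=
  (16 / (𝓔 ^ 2 * μ ^ 2) *
      (Real.sqrt (𝓔 - ω ^ 2 * b ^ 2 / 2) - Real.sqrt (𝓔 + h + μ / b))) *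
    (μ - 2 * e ^ 2 * b * Real.sqrt (𝓔 + h + μ / b) *
      (Real.sqrt (𝓔 + h + μ / b) - Real.sqrt (𝓔 - ω ^ 2 * b ^ 2 / 2))) *
    (𝓔 - e ^ 2 * Real.sqrt (𝓔 - ω ^ 2 * b ^ 2 / 2) *
      (Real.sqrt (𝓔 - ω ^ 2 * b ^ 2 / 2) - Real.sqrt (𝓔 + h + μ / b))) *
    (-μ * Real.sqrt (𝓔 - ω ^ 2 * b ^ 2 / 2) + 2 * b * Real.sqrt (𝓔 + h + μ / b) *
      (𝓔 - e ^ 2 * Real.sqrt (𝓔 - ω ^ 2 * b ^ 2 / 2) *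
      (Real.sqrt (𝓔 - ω ^ 2 * b ^ 2 / 2) - Real.sqrt (𝓔 + h + μ / b))))

lemma Delta0_eq_aux (𝓔 h μ ω e : ℝ) : Delta0 𝓔 h μ ω e = e ^ 2 * F0aux 𝓔 h μ ω e := by
  simp only [Delta0, F0aux]
  ring

lemma Delta1_eq_aux (𝓔 h μ ω e : ℝ) :
    Delta1 𝓔 h μ ω e = e ^ 2 * F1aux 𝓔 h μ ω e (Real.sqrt (1 - e ^ 2)) := by
  simp only [Delta1, F1aux]
  generalize Real.sqrt (𝓔 - ω ^ 2 * Real.sqrt (1 - e ^ 2) ^ 2 / 2) = x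
  generalize Real.sqrt (𝓔 + h + μ / Real.sqrt (1 - e ^ 2)) = y
  generalize Real.sqrt (1 - e ^ 2) = b
  ring

lemma F0aux_cont (𝓔 h μ ω : ℝ) : ContinuousAt (fun e => F0aux 𝓔 h μ ω e) 0 := by
  unfold F0aux
  fun_prop (disch := norm_num)

lemma F1aux_cont (𝓔 h μ ω : ℝ) :
    ContinuousAt (fun e => F1aux 𝓔 h μ ω e (Real.sqrt (1 - e ^ 2))) 0 := by
  unfold F1aux
  fun_prop (disch := norm_num)

lemma F0aux_zero (𝓔 h μ ω : ℝ) : F0aux 𝓔 h μ ω 0 =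
    (16 / (𝓔 ^ 2 * μ ^ 2) * (Real.sqrt (𝓔 + h + μ) - Real.sqrt (𝓔 - ω ^ 2 / 2)) * μ * 𝓔) *
      (2 * 𝓔 * Real.sqrt (𝓔 + h + μ) - μ * Real.sqrt (𝓔 - ω ^ 2 / 2)) := by
  simp only [F0aux]
  norm_num
  ring

lemma F1aux_zero (𝓔 h μ ω : ℝ) : F1aux 𝓔 h μ ω 0 (Real.sqrt (1 - 0 ^ 2)) =
    -((16 / (𝓔 ^ 2 * μ ^ 2) * (Real.sqrt (𝓔 + h + μ) - Real.sqrt (𝓔 - ω ^ 2 / 2)) * μ * 𝓔) *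
      (2 * 𝓔 * Real.sqrt (𝓔 + h + μ) - μ * Real.sqrt (𝓔 - ω ^ 2 / 2))) := by
  simp only [F1aux]
  norm_num
  ring

lemma exists_ebar_aux {P : ℝ → Prop} (hP : ∀ᶠ e in nhds (0:ℝ), P e) :
    ∃ ebar ∈ Set.Ioo (0:ℝ) 1, ∀ e ∈ Set.Ioo (0:ℝ) ebar, P e := by
  obtain ⟨δ, hδ, H⟩ := Metric.eventually_nhds_iff.1 hP
  refine ⟨min δ (1/2), ⟨by positivity, ?_⟩, fun e he => H ?_⟩
  · exact lt_of_le_of_lt (min_le_right _ _) (by norm_num)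
  · rw [Real.dist_eq, sub_zero, abs_of_pos he.1]
    exact lt_of_lt_of_le he.2 (min_le_left _ _)

/-- For small eccentricities the stability of the two homotetic orbits is
decided by the sign of `√(𝓔+h+μ)/μ − √(2𝓔−ω²)/(2√2·𝓔)`: in one regime the horizontal orbit
is stable (`Δ⁰ < 0`) and the vertical one unstable (`Δ¹ > 0`), in the other regime the
situation is reversed. -/
theorem homotetic_stability_small_eccentricity
    (𝓔 h μ ω : ℝ) (h𝓔 : 0 < 𝓔) (hh : 0 < h) (hμ : 0 < μ) (hω : 0 < ω)
    (hHill : ω ^ 2 < 2 * 𝓔) :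
    (Real.sqrt (𝓔 + h + μ) / μ < Real.sqrt (2 * 𝓔 - ω ^ 2) / (2 * Real.sqrt 2 * 𝓔) →
      ∃ ebar ∈ Set.Ioo (0:ℝ) 1, ∀ e ∈ Set.Ioo (0:ℝ) ebar,
        Delta0 𝓔 h μ ω e < 0 ∧ 0 < Delta1 𝓔 h μ ω e) ∧
    (Real.sqrt (2 * 𝓔 - ω ^ 2) / (2 * Real.sqrt 2 * 𝓔) < Real.sqrt (𝓔 + h + μ) / μ →
      ∃ ebar ∈ Set.Ioo (0:ℝ) 1, ∀ e ∈ Set.Ioo (0:ℝ) ebar,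
        0 < Delta0 𝓔 h μ ω e ∧ Delta1 𝓔 h μ ω e < 0) := by
  have hr : Real.sqrt (2 * 𝓔 - ω ^ 2) / (2 * Real.sqrt 2 * 𝓔)
      = Real.sqrt (𝓔 - ω ^ 2 / 2) / (2 * 𝓔) := by
    have h2 : Real.sqrt 2 ≠ 0 := by positivity
    rw [show 2 * 𝓔 - ω ^ 2 = 2 * (𝓔 - ω ^ 2 / 2) by ring,
      Real.sqrt_mul (by norm_num : (0:ℝ) ≤ 2)]
    field_simp
  have hlt : Real.sqrt (𝓔 - ω ^ 2 / 2) < Real.sqrt (𝓔 + h + μ) :=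
    Real.sqrt_lt_sqrt (by linarith) (by nlinarith [sq_nonneg ω])
  have hK : 0 < 16 / (𝓔 ^ 2 * μ ^ 2) *
      (Real.sqrt (𝓔 + h + μ) - Real.sqrt (𝓔 - ω ^ 2 / 2)) * μ * 𝓔 := by
    have := sub_pos.2 hlt
    positivity
  have c0 := F0aux_cont 𝓔 h μ ω
  have c1 := F1aux_cont 𝓔 h μ ω
  have z0 := F0aux_zero 𝓔 h μ ω
  have z1 := F1aux_zero 𝓔 h μ ω
  rw [hr]
  constructor
  · intro H
    rw [div_lt_div_iff₀ hμ (by positivity)] at H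
    have hD : 2 * 𝓔 * Real.sqrt (𝓔 + h + μ) - μ * Real.sqrt (𝓔 - ω ^ 2 / 2) < 0 := by
      linarith
    have hn := mul_neg_of_pos_of_neg hK hD
    have e0 := c0.eventually_lt_const (u := 0) (by simpa only [z0] using hn)
    have e1 := c1.eventually_const_lt (u := 0) (by beta_reduce; rw [z1]; linarith)
    obtain ⟨ebar, hb, hP⟩ := exists_ebar_aux (e0.and e1)
    refine ⟨ebar, hb, fun e he => ?_⟩
    have hp : 0 < e ^ 2 := pow_pos he.1 2
    rw [Delta0_eq_aux, Delta1_eq_aux]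
    exact ⟨mul_neg_of_pos_of_neg hp (hP e he).1, mul_pos hp (hP e he).2⟩
  · intro H
    rw [div_lt_div_iff₀ (by positivity) hμ] at H
    have hD : 0 < 2 * 𝓔 * Real.sqrt (𝓔 + h + μ) - μ * Real.sqrt (𝓔 - ω ^ 2 / 2) := by
      linarith
    have hn := mul_pos hK hD
    have e0 := c0.eventually_const_lt (u := 0) (by simpa only [z0] using hn)
    have e1 := c1.eventually_lt_const (u := 0) (by beta_reduce; rw [z1]; linarith)
    obtain ⟨ebar, hb, hP⟩ := exists_ebar_aux (e0.and e1)
    refine ⟨ebar, hb, fun e he => ?_⟩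
    have hp : 0 < e ^ 2 := pow_pos he.1 2
    rw [Delta0_eq_aux, Delta1_eq_aux]
    exact ⟨mul_pos hp (hP e he).1, mul_neg_of_pos_of_neg hp (hP e he).2⟩
end

section
/- Fix 𝓔, ω, μ > 0 with 2𝓔 > ω² and an eccentricity e ∈ (0,1). Then there exists h̄ > 0 such that for every h > h̄ one has Δ⁰ > 0 and Δ¹ > 0; in particular, for h large enough both homotetic collision-ejection orbits of the elliptic refraction billiard are linearly unstable saddles. -/
lemma aux0 (𝓔 μ e s t : ℝ) (h𝓔 : 0 < 𝓔) (hμ : 0 < μ) (h0 : 0 < e) (h1 : 0 < 1 - e ^ 2)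
    (hs : 0 < s) (ht : s + 𝓔 / (e ^ 2 / (1 - e ^ 2) * s) < t) :
    0 < -(16 / (𝓔 ^ 2 * μ ^ 2)) * (e ^ 2 / (1 - e ^ 2)) * (s - t) *
      (μ + 2 * e ^ 2 / (1 - e ^ 2) * t * (t - s)) *
      (𝓔 + e ^ 2 / (1 - e ^ 2) * s * (s - t)) *
      (-μ * s + 2 * t * (𝓔 + e ^ 2 / (1 - e ^ 2) * s * (s - t))) := by
  have hk : 0 < e ^ 2 / (1 - e ^ 2) := by positivity
  have hpos : 0 < 𝓔 / (e ^ 2 / (1 - e ^ 2) * s) := by positivity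
  have hst : 0 < t - s := by linarith
  have htp : 0 < t := by linarith
  have hC : 𝓔 + e ^ 2 / (1 - e ^ 2) * s * (s - t) < 0 := by
    have h2 : 𝓔 / (e ^ 2 / (1 - e ^ 2) * s) < t - s := by linarith
    rw [div_lt_iff₀ (by positivity)] at h2
    linarith
  have hD : -μ * s + 2 * t * (𝓔 + e ^ 2 / (1 - e ^ 2) * s * (s - t)) < 0 := by
    have h3 := mul_neg_of_pos_of_neg (show 0 < 2 * t by linarith) hC
    have h4 : 0 < μ * s := by positivity
    linarith
  have hA : 0 < -(16 / (𝓔 ^ 2 * μ ^ 2)) * (e ^ 2 / (1 - e ^ 2)) * (s - t) := by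
    have : 0 < (16 / (𝓔 ^ 2 * μ ^ 2)) * (e ^ 2 / (1 - e ^ 2)) * (t - s) := by positivity
    linarith
  have hB : 0 < μ + 2 * e ^ 2 / (1 - e ^ 2) * t * (t - s) := by positivity
  exact mul_pos_of_neg_of_neg (mul_neg_of_pos_of_neg (mul_pos hA hB) hC) hD

lemma aux1 (𝓔 μ e b s t : ℝ) (h𝓔 : 0 < 𝓔) (hμ : 0 < μ) (h0 : 0 < e) (hb : 0 < b)
    (hs : 0 ≤ s) (ht : s + 1 + μ / (2 * e ^ 2 * b) + μ * s / (2 * b * 𝓔) < t) :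
    0 < 16 * e ^ 2 / (𝓔 ^ 2 * μ ^ 2) * (s - t) *
      (μ - 2 * e ^ 2 * b * t * (t - s)) *
      (𝓔 - e ^ 2 * s * (s - t)) *
      (-μ * s + 2 * b * t * (𝓔 - e ^ 2 * s * (s - t))) := by
  have p1 : 0 < μ / (2 * e ^ 2 * b) := by positivity
  have p2 : 0 ≤ μ * s / (2 * b * 𝓔) := by positivity
  have hst : 1 < t - s := by linarith
  have hst' : 0 < t - s := by linarith
  have htp : 0 < t := by linarith
  have hA : 16 * e ^ 2 / (𝓔 ^ 2 * μ ^ 2) * (s - t) < 0 :=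
    mul_neg_of_pos_of_neg (by positivity) (by linarith)
  have hB : μ - 2 * e ^ 2 * b * t * (t - s) < 0 := by
    have h2 : μ / (2 * e ^ 2 * b) < t := by linarith
    rw [div_lt_iff₀ (by positivity)] at h2
    have h3 : 0 < t * (2 * e ^ 2 * b) := by positivity
    nlinarith [mul_pos h3 (sub_pos.2 hst)]
  have hC : 𝓔 ≤ 𝓔 - e ^ 2 * s * (s - t) := by
    have : 0 ≤ e ^ 2 * s * (t - s) := by positivity
    linarith
  have hD : 0 < -μ * s + 2 * b * t * (𝓔 - e ^ 2 * s * (s - t)) := by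
    have h2 : μ * s / (2 * b * 𝓔) < t := by linarith
    rw [div_lt_iff₀ (by positivity)] at h2
    have h3 := mul_le_mul_of_nonneg_left hC (show 0 ≤ 2 * b * t by positivity)
    linarith
  exact mul_pos (mul_pos (mul_pos_of_neg_of_neg hA hB) (by linarith)) hD

/-- For `h` large enough both homotetic collision-ejection orbits of the
elliptic refraction billiard are linearly unstable saddles: `Δ⁰ > 0` and `Δ¹ > 0`. -/
theorem homotetic_both_unstable_large_h
    (𝓔 μ ω e : ℝ) (h𝓔 : 0 < 𝓔) (hμ : 0 < μ) (hω : 0 < ω)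
    (hHill : ω ^ 2 < 2 * 𝓔) (he : e ∈ Set.Ioo (0:ℝ) 1) :
    ∃ hbar > (0:ℝ), ∀ h > hbar, 0 < Delta0 𝓔 h μ ω e ∧ 0 < Delta1 𝓔 h μ ω e := by
  obtain ⟨h0, h1⟩ := he
  have hb2 : 0 < 1 - e ^ 2 := by nlinarith
  have hb : 0 < Real.sqrt (1 - e ^ 2) := Real.sqrt_pos.2 hb2
  have hs0 : 0 < Real.sqrt (𝓔 - ω ^ 2 / 2) := Real.sqrt_pos.2 (by linarith)
  have hs1 : 0 ≤ Real.sqrt (𝓔 - ω ^ 2 * Real.sqrt (1 - e ^ 2) ^ 2 / 2) := Real.sqrt_nonneg _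
  have key0 := fun t => aux0 𝓔 μ e _ t h𝓔 hμ h0 hb2 hs0
  have key1 := fun t => aux1 𝓔 μ e _ _ t h𝓔 hμ h0 hb hs1
  refine ⟨_, lt_of_lt_of_le one_pos (le_add_of_nonneg_right (add_nonneg (sq_nonneg
    (Real.sqrt (𝓔 - ω ^ 2 / 2) + 𝓔 / (e ^ 2 / (1 - e ^ 2) * Real.sqrt (𝓔 - ω ^ 2 / 2))))
    (sq_nonneg (Real.sqrt (𝓔 - ω ^ 2 * Real.sqrt (1 - e ^ 2) ^ 2 / 2) + 1
      + μ / (2 * e ^ 2 * Real.sqrt (1 - e ^ 2))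
      + μ * Real.sqrt (𝓔 - ω ^ 2 * Real.sqrt (1 - e ^ 2) ^ 2 / 2)
        / (2 * Real.sqrt (1 - e ^ 2) * 𝓔))))), ?_⟩
  intro h hh
  have hp : 0 < μ / Real.sqrt (1 - e ^ 2) := by positivity
  constructor
  · refine key0 _ (Real.lt_sqrt_of_sq_lt ?_)
    refine lt_of_le_of_lt ?_ (show h < _ by linarith)
    refine le_trans ?_ (le_of_lt hh)
    rw [← add_assoc]
    exact le_trans (le_add_of_nonneg_left zero_le_one) (le_add_of_nonneg_right (sq_nonneg _))
  · refine key1 _ (Real.lt_sqrt_of_sq_lt ?_)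
    refine lt_of_le_of_lt ?_ (show h < _ by linarith)
    refine le_trans ?_ (le_of_lt hh)
    rw [← add_assoc]
    exact le_add_of_nonneg_left (add_nonneg zero_le_one (sq_nonneg _))
end

section
/- Fix 𝓔, ω, h > 0 with 2𝓔 > ω² and an eccentricity e ∈ (0,1) with e² ≠ 1/2. Then there exists μ̄ > 0 such that for every μ > μ̄ one has Δ⁰ > 0 and Δ¹ > 0; in particular, for μ large enough both homotetic collision-ejection orbits of the elliptic refraction billiard are linearly unstable saddles. -/
open Filter in
theorem quad_pos_aux (a c d : ℝ) (ha : 0 < a) :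
    ∀ᶠ x : ℝ in atTop, 0 < a * x ^ 2 + c * x + d := by
  filter_upwards [eventually_gt_atTop (1 + (|c| + |d|) / a)] with x hx
  have h0 : 0 ≤ (|c| + |d|) / a := by positivity
  have h1 : |c| + |d| < a * x := by
    have : (|c| + |d|) / a < x := by linarith
    rw [div_lt_iff₀ ha] at this
    linarith
  have hx1 : 1 < x := by linarith
  have h2 : 0 < (a * x - (|c| + |d|)) * x := mul_pos (by linarith) (by linarith)
  have h3 : 0 ≤ (c + |c|) * x := mul_nonneg (by linarith [neg_abs_le c]) (by linarith)
  have h4 : 0 ≤ |d| * (x - 1) := mul_nonneg (abs_nonneg d) (by linarith)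
  nlinarith [neg_abs_le d]

/-- For `μ` large enough (and `e² ≠ 1/2`) both homotetic collision-ejection
orbits of the elliptic refraction billiard are linearly unstable saddles:
`Δ⁰ > 0` and `Δ¹ > 0`. -/
theorem homotetic_both_unstable_large_mu
    (𝓔 h ω e : ℝ) (h𝓔 : 0 < 𝓔) (hh : 0 < h) (hω : 0 < ω)
    (hHill : ω ^ 2 < 2 * 𝓔) (he : e ∈ Set.Ioo (0:ℝ) 1) (he2 : e ^ 2 ≠ 1/2) :
    ∃ μbar > (0:ℝ), ∀ μ > μbar, 0 < Delta0 𝓔 h μ ω e ∧ 0 < Delta1 𝓔 h μ ω e := by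
  obtain ⟨he0, he1⟩ := he
  have hq : 0 < 1 - e ^ 2 := by nlinarith
  have hb : 0 < Real.sqrt (1 - e ^ 2) := Real.sqrt_pos.mpr hq
  have hb2 : Real.sqrt (1 - e ^ 2) ^ 2 = 1 - e ^ 2 := Real.sq_sqrt hq.le
  have hE0 : 0 < 𝓔 - ω ^ 2 / 2 := by linarith
  have hE1 : 0 < 𝓔 - ω ^ 2 * Real.sqrt (1 - e ^ 2) ^ 2 / 2 := by
    rw [hb2]; nlinarith [mul_pos (pow_pos hω 2) (pow_pos he0 2)]
  have key : ∀ᶠ μ : ℝ in Filter.atTop, 0 < Delta0 𝓔 h μ ω e ∧ 0 < Delta1 𝓔 h μ ω e := by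
    refine Filter.Eventually.and ?_ ?_
    · have hs := Real.sqrt_pos.mpr hE0
      have ht : 0 < e ^ 2 / (1 - e ^ 2) := by positivity
      have hlim : Filter.Tendsto (fun μ : ℝ => Real.sqrt (𝓔 + h + μ)) Filter.atTop Filter.atTop :=
        Real.tendsto_sqrt_atTop.comp (Filter.tendsto_atTop_add_const_left _ _ Filter.tendsto_id)
      filter_upwards [Filter.eventually_gt_atTop 0,
        hlim.eventually (Filter.eventually_gt_atTop (Real.sqrt (𝓔 - ω ^ 2 / 2) +
          𝓔 / (e ^ 2 / (1 - e ^ 2) * Real.sqrt (𝓔 - ω ^ 2 / 2))))] with μ hμ hx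
      unfold Delta0
      dsimp only
      rw [show 2 * e ^ 2 / (1 - e ^ 2) = 2 * (e ^ 2 / (1 - e ^ 2)) by ring]
      generalize Real.sqrt (𝓔 - ω ^ 2 / 2) = s at *
      generalize Real.sqrt (𝓔 + h + μ) = x at *
      generalize e ^ 2 / (1 - e ^ 2) = t at *
      have hts : 0 < t * s := mul_pos ht hs
      have hd : 0 < 𝓔 / (t * s) := by positivity
      have hxs : 0 < x - s := by linarith
      have hx0 : 0 < x := by linarith
      have hC : 𝓔 + t * s * (s - x) < 0 := by
        have : 𝓔 / (t * s) < x - s := by linarith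
        rw [div_lt_iff₀ hts] at this
        linarith
      have hA : 0 < -(16 / (𝓔 ^ 2 * μ ^ 2)) * t * (s - x) := by
        have : 0 < (16 / (𝓔 ^ 2 * μ ^ 2)) * t * (x - s) := by positivity
        linarith
      have hB : 0 < μ + 2 * t * x * (x - s) := by positivity
      have hD : -μ * s + 2 * x * (𝓔 + t * s * (s - x)) < 0 := by
        have h1 : 0 < μ * s := by positivity
        have h2 : 2 * x * (𝓔 + t * s * (s - x)) < 0 := mul_neg_of_pos_of_neg (by linarith) hC
        linarith
      exact mul_pos_of_neg_of_neg (mul_neg_of_pos_of_neg (mul_pos hA hB) hC) hD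
    · have hs := Real.sqrt_pos.mpr hE1
      have hlim : Filter.Tendsto (fun μ : ℝ => Real.sqrt (𝓔 + h + μ / Real.sqrt (1 - e ^ 2)))
          Filter.atTop Filter.atTop :=
        Real.tendsto_sqrt_atTop.comp (Filter.tendsto_atTop_add_const_left _ _
          (Filter.tendsto_id.atTop_div_const hb))
      have hBD : ∀ᶠ x : ℝ in Filter.atTop, ∀ s, s = Real.sqrt (𝓔 - ω ^ 2 * Real.sqrt (1 - e ^ 2) ^ 2 / 2) →
          ((1 - 2 * e ^ 2) * x ^ 2 + 2 * e ^ 2 * s * x + -(𝓔 + h)) *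
          ((2 * e ^ 2 - 1) * s * x ^ 2 + 2 * (𝓔 - e ^ 2 * s ^ 2) * x + (𝓔 + h) * s) < 0 := by
        generalize Real.sqrt (𝓔 - ω ^ 2 * Real.sqrt (1 - e ^ 2) ^ 2 / 2) = s at hs ⊢
        rcases lt_or_gt_of_ne he2 with hlt | hgt
        · have ha : 0 < 1 - 2 * e ^ 2 := by linarith
          filter_upwards [quad_pos_aux _ (2 * e ^ 2 * s) (-(𝓔 + h)) ha,
            quad_pos_aux _ (-(2 * (𝓔 - e ^ 2 * s ^ 2))) (-((𝓔 + h) * s)) (mul_pos ha hs)]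
            with x h1 h2
          rintro _ rfl
          exact mul_neg_of_pos_of_neg h1 (by linarith)
        · have ha : 0 < 2 * e ^ 2 - 1 := by linarith
          filter_upwards [quad_pos_aux _ (-(2 * e ^ 2 * s)) (𝓔 + h) ha,
            quad_pos_aux _ (2 * (𝓔 - e ^ 2 * s ^ 2)) ((𝓔 + h) * s) (mul_pos ha hs)]
            with x h1 h2
          rintro _ rfl
          exact mul_neg_of_neg_of_pos (by linarith) h2
      filter_upwards [Filter.eventually_gt_atTop 0, hlim.eventually hBD,
        hlim.eventually (Filter.eventually_gt_atTop
          (Real.sqrt (𝓔 - ω ^ 2 * Real.sqrt (1 - e ^ 2) ^ 2 / 2)))] with μ hμ hx hxs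
      replace hx := hx _ rfl
      unfold Delta1
      dsimp only
      have hx2 : Real.sqrt (𝓔 + h + μ / Real.sqrt (1 - e ^ 2)) ^ 2 =
          𝓔 + h + μ / Real.sqrt (1 - e ^ 2) := Real.sq_sqrt (by positivity)
      generalize Real.sqrt (𝓔 - ω ^ 2 * Real.sqrt (1 - e ^ 2) ^ 2 / 2) = s at *
      generalize Real.sqrt (𝓔 + h + μ / Real.sqrt (1 - e ^ 2)) = x at *
      generalize Real.sqrt (1 - e ^ 2) = b at *
      have hμx : μ = b * (x ^ 2 - (𝓔 + h)) := by
        rw [hx2]; field_simp; ring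
      have hA : 16 * e ^ 2 / (𝓔 ^ 2 * μ ^ 2) * (s - x) < 0 :=
        mul_neg_of_pos_of_neg (by positivity) (by linarith)
      have hC : 0 < 𝓔 - e ^ 2 * s * (s - x) := by
        have : 0 < e ^ 2 * s * (x - s) := mul_pos (by positivity) (by linarith)
        linarith
      have hBD' : (μ - 2 * e ^ 2 * b * x * (x - s)) *
          (-μ * s + 2 * b * x * (𝓔 - e ^ 2 * s * (s - x))) < 0 := by
        have h1 := mul_neg_of_pos_of_neg (pow_pos hb 2) hx
        have h2 : (μ - 2 * e ^ 2 * b * x * (x - s)) *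
          (-μ * s + 2 * b * x * (𝓔 - e ^ 2 * s * (s - x))) = b ^ 2 *
          (((1 - 2 * e ^ 2) * x ^ 2 + 2 * e ^ 2 * s * x + -(𝓔 + h)) *
          ((2 * e ^ 2 - 1) * s * x ^ 2 + 2 * (𝓔 - e ^ 2 * s ^ 2) * x + (𝓔 + h) * s)) := by
          rw [hμx]; ring
        rw [h2]; exact h1
      have h3 := mul_pos (mul_pos_of_neg_of_neg hA hBD') hC
      linarith
  obtain ⟨M, hM⟩ := Filter.eventually_atTop.mp key
  exact ⟨max M 1, by positivity, fun μ hμ => hM μ ((le_max_left _ _).trans (le_of_lt hμ))⟩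
end

section
/- Fix ω, h, μ > 0 and an eccentricity e ∈ (0,1). Then, as 𝓔 → +∞ (along 𝓔 with 2𝓔 > ω²), the discriminant Δ⁰, regarded as a function of 𝓔, converges to the limit ℓ₀ := 4e²·(2h + 2μ + ω²)·(2μ + e²(2h + ω²)) / ((1−e²)²·μ²), and ℓ₀ > 0; in particular, for 𝓔 sufficiently large the horizontal homotetic orbit is linearly unstable. -/
lemma delta0_alg (r x y m k d : ℝ) (hr : 0 < r) (hm : 0 < m) (hxy : 0 < x + y)
    (hd : r ^ 2 * (y ^ 2 - x ^ 2) = d) :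
    (-(16 / ((r ^ 2) ^ 2 * m ^ 2)) * k * (r * x - r * y)) *
      (m + 2 * k * (r * y) * (r * y - r * x)) *
      (r ^ 2 + k * (r * x) * (r * x - r * y)) *
      (-m * (r * x) + 2 * (r * y) * (r ^ 2 + k * (r * x) * (r * x - r * y))) =
    16 * k / m ^ 2 * (d / (x + y)) * (m + 2 * k * y * (d / (x + y))) * (1 - k * x * (y - x)) *
      (-m * x * (r ^ 2)⁻¹ + 2 * y * (1 - k * x * (y - x))) := by
  have h1 : d / (x + y) = r ^ 2 * (y - x) := by
    rw [div_eq_iff hxy.ne', ← hd]; ring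
  rw [h1]
  field_simp
  ring

theorem delta0_limit_large_energy
    (h μ ω e : ℝ) (hh : 0 < h) (hμ : 0 < μ) (hω : 0 < ω) (he : e ∈ Set.Ioo (0:ℝ) 1) :
    let l₀ := 4 * e ^ 2 * (2 * h + 2 * μ + ω ^ 2) * (2 * μ + e ^ 2 * (2 * h + ω ^ 2)) /
      ((1 - e ^ 2) ^ 2 * μ ^ 2)
    Filter.Tendsto (fun 𝓔 => Delta0 𝓔 h μ ω e) Filter.atTop (nhds l₀) ∧ 0 < l₀ := by
  obtain ⟨he0, he1⟩ := he
  have hb : 0 < 1 - e ^ 2 := by nlinarith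
  intro l₀
  refine ⟨?_, by positivity⟩
  let x : ℝ → ℝ := fun t => Real.sqrt (1 - ω ^ 2 / 2 * t)
  let y : ℝ → ℝ := fun t => Real.sqrt (1 + (h + μ) * t)
  let k : ℝ := e ^ 2 / (1 - e ^ 2)
  let d : ℝ := h + μ + ω ^ 2 / 2
  let F : ℝ → ℝ := fun t =>
    16 * k / μ ^ 2 * (d / (x t + y t)) * (μ + 2 * k * y t * (d / (x t + y t))) *
      (1 - k * x t * (y t - x t)) *
      (-μ * x t * t + 2 * y t * (1 - k * x t * (y t - x t)))
  have hx0 : x 0 = 1 := by simp [x]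
  have hy0 : y 0 = 1 := by simp [y]
  have hxc : ContinuousAt x 0 := by dsimp only [x]; fun_prop
  have hyc : ContinuousAt y 0 := by dsimp only [y]; fun_prop
  have hdc : ContinuousAt (fun t => d / (x t + y t)) 0 :=
    continuousAt_const.div (hxc.add hyc) (by rw [hx0, hy0]; norm_num)
  have hF : ContinuousAt F 0 := by dsimp only [F]; fun_prop
  have hF0 : F 0 = l₀ := by
    simp only [F, hx0, hy0, l₀, k, d]
    field_simp
    ring
  have hT : Filter.Tendsto (fun E : ℝ => F E⁻¹) Filter.atTop (nhds l₀) := by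
    rw [← hF0]
    exact hF.tendsto.comp tendsto_inv_atTop_zero
  refine hT.congr' ?_
  filter_upwards [Filter.eventually_gt_atTop (ω ^ 2 / 2), Filter.eventually_gt_atTop 0]
    with E hE1 hE0
  have hr : 0 < Real.sqrt E := Real.sqrt_pos.mpr hE0
  have hr2 : Real.sqrt E ^ 2 = E := Real.sq_sqrt hE0.le
  have hvE : Real.sqrt (E - ω ^ 2 / 2) = Real.sqrt E * x E⁻¹ := by
    rw [← Real.sqrt_mul hE0.le]; congr 1; field_simp
  have hvI : Real.sqrt (E + h + μ) = Real.sqrt E * y E⁻¹ := by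
    rw [← Real.sqrt_mul hE0.le]; congr 1; field_simp; ring
  have hxn : 0 ≤ x E⁻¹ := Real.sqrt_nonneg _
  have hyp : 0 < y E⁻¹ := Real.sqrt_pos.mpr (by positivity)
  have hd : Real.sqrt E ^ 2 * (y E⁻¹ ^ 2 - x E⁻¹ ^ 2) = d := by
    rw [mul_sub, ← mul_pow, ← mul_pow, ← hvE, ← hvI, Real.sq_sqrt (by linarith),
      Real.sq_sqrt (by linarith)]
    simp only [d]; ring
  have key := delta0_alg _ _ _ μ k d hr hμ (by linarith) hd
  rw [hr2] at key
  simp only [Delta0, hvE, hvI, F]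
  rw [← key]
  simp only [k]
  ring
end

section
/- Let μ > 0 and h̃ > 0, let I ⊆ ℝ be an interval, and let z : I → ℝ² be of class C² with z(t) ≠ 0 for all t ∈ I, satisfying the Kepler equation z''(t) = −μ·z(t)/|z(t)|³ and the energy relation ½|z'(t)|² − μ/|z(t)| = h̃ for all t ∈ I. Then z'(t) ≠ 0 for all t, and for every t ∈ I the curvature of the trajectory satisfies |z'(t) × z''(t)| / |z'(t)|³ ≤ μ / (2·|z(t)|·(|z(t)|·h̃ + μ)), where u × v = u₁v₂ − u₂v₁ denotes the planar cross product. -/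
noncomputable section

/-- Along a Keplerian hyperbola with energy `h̃ > 0` and central mass
`μ > 0` (i.e. a solution of `z'' = −μz/|z|³` with `½|z'|² − μ/|z| = h̃`), the velocity never
vanishes and the curvature of the trajectory is bounded by `μ/(2|z|(|z|h̃ + μ))`. -/
theorem kepler_hyperbola_curvature_bound
    (μ ht : ℝ) (hμ : 0 < μ) (hht : 0 < ht)
    (I : Set ℝ) (hI : I.OrdConnected)
    (z : ℝ → EuclideanSpace ℝ (Fin 2))
    (hz : ContDiff ℝ 2 z)
    (hzne : ∀ t ∈ I, z t ≠ 0)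
    (hode : ∀ t ∈ I, deriv (deriv z) t = (-(μ / ‖z t‖ ^ 3)) • z t)
    (henergy : ∀ t ∈ I, (1:ℝ)/2 * ‖deriv z t‖ ^ 2 - μ / ‖z t‖ = ht) :
    ∀ t ∈ I, deriv z t ≠ 0 ∧
      |deriv z t 0 * deriv (deriv z) t 1 - deriv z t 1 * deriv (deriv z) t 0|
          / ‖deriv z t‖ ^ 3
        ≤ μ / (2 * ‖z t‖ * (‖z t‖ * ht + μ)) := by
  intro t ht'
  have hr : 0 < ‖z t‖ := norm_pos_iff.mpr (hzne t ht')
  have hE := henergy t ht'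
  have hO := hode t ht'
  have hv : 0 < ‖deriv z t‖ := by
    rcases (norm_nonneg (deriv z t)).eq_or_lt with h | h
    · rw [← h] at hE
      have : 0 < μ / ‖z t‖ := by positivity
      nlinarith
    · exact h
  refine ⟨norm_pos_iff.mp hv, ?_⟩
  have hrs : ‖z t‖ ^ 2 = z t 0 ^ 2 + z t 1 ^ 2 := by
    simp [EuclideanSpace.norm_sq_eq, Fin.sum_univ_two]
  have hvs : ‖deriv z t‖ ^ 2 = deriv z t 0 ^ 2 + deriv z t 1 ^ 2 := by
    simp [EuclideanSpace.norm_sq_eq, Fin.sum_univ_two]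
  rw [hO]
  simp only [PiLp.smul_apply, smul_eq_mul]
  generalize ‖z t‖ = r at *
  generalize ‖deriv z t‖ = v at *
  generalize z t 0 = x at *
  generalize z t 1 = y at *
  generalize deriv z t 0 = a at *
  generalize deriv z t 1 = b at *
  have hc : |a * y - b * x| ≤ v * r := by
    refine abs_le_of_sq_le_sq ?_ (by positivity)
    rw [mul_pow, hrs, hvs]
    nlinarith [sq_nonneg (a * x + b * y)]
  have hden : 2 * r * (r * ht + μ) = r ^ 2 * v ^ 2 := by
    rw [← hE]
    field_simp
    ring
  have hfac : a * (-(μ / r ^ 3) * y) - b * (-(μ / r ^ 3) * x)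
      = -(μ / r ^ 3) * (a * y - b * x) := by ring
  rw [hden, hfac, abs_mul, abs_neg, abs_of_pos (by positivity : 0 < μ / r ^ 3)]
  calc μ / r ^ 3 * |a * y - b * x| / v ^ 3 ≤ μ / r ^ 3 * (v * r) / v ^ 3 := by gcongr
    _ = μ / (r ^ 2 * v ^ 2) := by field_simp
end
end

section
/- Let μ > 0, h̃ > 0, and b ∈ (1/√2, 1] (i.e. the ellipse {(x,y) : x² + y²/b² = 1} has eccentricity e = √(1−b²) < 1/√2). Let I ⊆ ℝ be an interval and let z : I → ℝ² be of class C² with z(t) ≠ 0 for all t ∈ I, satisfying the Kepler equation z''(t) = −μ·z(t)/|z(t)|³ and the energy relation ½|z'(t)|² − μ/|z(t)| = h̃ for all t ∈ I. Then the set { t ∈ I : z(t)₁² + z(t)₂²/b² = 1 } contains at most two elements; that is, the solution crosses the ellipse at most twice. -/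
noncomputable section

/-- Convexity for hyperbolae of low-eccentricity ellipses: a Keplerian
hyperbola with energy `h̃ > 0` and central mass `μ > 0` crosses the ellipse
`x² + y²/b² = 1` with `b ∈ (1/√2, 1]` (eccentricity `< 1/√2`) in at most two points. -/
theorem ellipse_convex_for_hyperbolae
    (μ ht b : ℝ) (hμ : 0 < μ) (hht : 0 < ht)
    (hb : b ∈ Set.Ioc (1 / Real.sqrt 2) 1)
    (I : Set ℝ) (hI : I.OrdConnected)
    (z : ℝ → EuclideanSpace ℝ (Fin 2))
    (hz : ContDiff ℝ 2 z)
    (hzne : ∀ t ∈ I, z t ≠ 0)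
    (hode : ∀ t ∈ I, deriv (deriv z) t = (-(μ / ‖z t‖ ^ 3)) • z t)
    (henergy : ∀ t ∈ I, (1:ℝ)/2 * ‖deriv z t‖ ^ 2 - μ / ‖z t‖ = ht) :
    ∃ t₁ t₂ : ℝ,
      {t ∈ I | (z t 0) ^ 2 + (z t 1) ^ 2 / b ^ 2 = 1} ⊆ {t₁, t₂} := by
  have hb0 : 0 < b := lt_trans (by positivity) hb.1
  have hb2 : 1 / 2 < b ^ 2 := by
    have h1 : (1 / Real.sqrt 2) ^ 2 < b ^ 2 := by
      apply pow_lt_pow_left₀ hb.1 (by positivity) (by norm_num)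
    have h2 : (1 / Real.sqrt 2) ^ 2 = 1 / 2 := by
      rw [div_pow, Real.sq_sqrt (by norm_num)]; norm_num
    linarith
  have hb3 : b ^ 2 ≤ 1 := by nlinarith [hb.2]
  have hd1 : ∀ t, HasDerivAt z (deriv z t) t := fun t =>
    ((hz.differentiable (by norm_num)) t).hasDerivAt
  have hz' : ContDiff ℝ 1 (deriv z) := by
    have h2 : ContDiff ℝ (1 + 1) z := by
      have e : (1 + 1 : WithTop ℕ∞) = 2 := by norm_num
      rw [e]; exact hz
    exact (contDiff_succ_iff_deriv.1 h2).2.2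
  have hd2 : ∀ t, HasDerivAt (deriv z) (deriv (deriv z) t) t := fun t =>
    ((hz'.differentiable (by norm_num)) t).hasDerivAt
  have hc1 : ∀ i t, HasDerivAt (fun s => z s i) (deriv z t i) t := fun i t =>
    (EuclideanSpace.proj i : EuclideanSpace ℝ (Fin 2) →L[ℝ] ℝ).hasFDerivAt.comp_hasDerivAt t (hd1 t)
  have hc2 : ∀ i t, HasDerivAt (fun s => deriv z s i) (deriv (deriv z) t i) t := fun i t =>
    (EuclideanSpace.proj i : EuclideanSpace ℝ (Fin 2) →L[ℝ] ℝ).hasFDerivAt.comp_hasDerivAt t (hd2 t)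
  set f : ℝ → ℝ := fun t => (z t 0) ^ 2 + (z t 1) ^ 2 / b ^ 2 with hf
  have hf1 : ∀ t, HasDerivAt f (2 * (z t 0 * deriv z t 0) + 2 * (z t 1 * deriv z t 1) / b ^ 2) t := by
    intro t
    have h := ((hc1 0 t).pow 2).add (((hc1 1 t).pow 2).div_const (b ^ 2))
    refine HasDerivAt.congr_deriv (f := f) h ?_
    norm_num
    ring
  have hf1' : deriv f = fun t => 2 * (z t 0 * deriv z t 0) + 2 * (z t 1 * deriv z t 1) / b ^ 2 :=
    funext fun t => (hf1 t).deriv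
  have hf2 : ∀ t, deriv (deriv f) t =
      2 * (deriv z t 0 * deriv z t 0 + z t 0 * deriv (deriv z) t 0)
      + 2 * (deriv z t 1 * deriv z t 1 + z t 1 * deriv (deriv z) t 1) / b ^ 2 := by
    intro t
    rw [hf1']
    exact ((((hc1 0 t).mul (hc2 0 t)).const_mul 2).add
      ((((hc1 1 t).mul (hc2 1 t)).const_mul 2).div_const (b ^ 2))).deriv
  have hpos : ∀ t ∈ I, 0 < deriv (deriv f) t := by
    intro t ht'
    have hr : 0 < ‖z t‖ := norm_pos_iff.2 (hzne t ht')
    have hE := henergy t ht'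
    have hr2 : ‖z t‖ ^ 2 = z t 0 ^ 2 + z t 1 ^ 2 := by
      simp [EuclideanSpace.norm_sq_eq, Fin.sum_univ_two]
    have hv2 : ‖deriv z t‖ ^ 2 = deriv z t 0 ^ 2 + deriv z t 1 ^ 2 := by
      simp [EuclideanSpace.norm_sq_eq, Fin.sum_univ_two]
    rw [hf2, hode t ht']
    simp only [PiLp.smul_apply, smul_eq_mul]
    rw [hv2] at hE
    generalize deriv z t 0 = u at *
    generalize deriv z t 1 = v at *
    generalize z t 0 = x at *
    generalize z t 1 = y at *
    generalize ‖z t‖ = r at *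
    have hk : 0 < μ / r ^ 3 := by positivity
    have hkr : μ / r = μ / r ^ 3 * r ^ 2 := by field_simp
    rw [hkr, hr2] at hE
    generalize μ / r ^ 3 = k at *
    have hc : 1 ≤ (b ^ 2)⁻¹ := (one_le_inv₀ (by positivity)).2 hb3
    have hc' : (b ^ 2)⁻¹ < 2 := by
      rw [inv_lt_comm₀ (by positivity) (by norm_num)]; linarith
    simp only [div_eq_mul_inv]
    generalize (b ^ 2)⁻¹ = c at *
    nlinarith [mul_nonneg (sub_nonneg.2 hc) (sq_nonneg v),
      mul_nonneg hk.le (sq_nonneg x), mul_nonneg (mul_nonneg hk.le (sq_nonneg y)) (sub_nonneg.2 hc'.le)]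
  have key : ∀ p q s, p ∈ I → s ∈ I → f p = 1 → f q = 1 → f s = 1 → p < q → q < s → False := by
    intro p q s hp hs fp fq fs hpq hqs
    have hconv : StrictConvexOn ℝ (Set.Icc p s) f := by
      apply strictConvexOn_of_deriv2_pos (convex_Icc p s)
      · exact fun t _ => (hf1 t).continuousAt.continuousWithinAt
      · intro t ht'
        exact hpos t (hI.out hp hs (interior_subset ht'))
    have hps := hpq.trans hqs
    have := hconv.lt_on_openSegment (Set.left_mem_Icc.2 hps.le) (Set.right_mem_Icc.2 hps.le) hps.ne
      (z := q) (by rw [openSegment_eq_Ioo hps]; exact ⟨hpq, hqs⟩)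
    rw [fp, fq, fs, max_self] at this
    exact lt_irrefl _ this
  by_contra! hcon
  obtain ⟨p, hp, -⟩ := Set.not_subset.1 (hcon 0 0)
  obtain ⟨q, hq, hqp⟩ := Set.not_subset.1 (hcon p p)
  obtain ⟨s, hs, hsp⟩ := Set.not_subset.1 (hcon p q)
  simp only [Set.mem_insert_iff, Set.mem_singleton_iff, not_or] at hqp hsp
  obtain ⟨hpI, hp1⟩ := hp
  obtain ⟨hqI, hq1⟩ := hq
  obtain ⟨hsI, hs1⟩ := hs
  rcases lt_or_gt_of_ne hqp.1 with h1 | h1 <;> rcases lt_or_gt_of_ne hsp.1 with h2 | h2 <;>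
    rcases lt_or_gt_of_ne hsp.2 with h3 | h3
  · exact key s q p hsI hpI hs1 hq1 hp1 h3 h1
  · exact key q s p hqI hpI hq1 hs1 hp1 h3 h2
  · linarith
  · exact key q p s hqI hsI hq1 hp1 hs1 h1 h2
  · exact key s p q hsI hqI hs1 hp1 hq1 h2 h1
  · linarith
  · exact key p s q hpI hqI hp1 hs1 hq1 h2 h3
  · exact key p q s hpI hsI hp1 hq1 hs1 h1 h3
end
end

section
/- Let 𝓔, ω > 0 with 2𝓔 > ω² and let e ∈ (0, 1/√2), b = √(1−e²). For h, μ > 0 define vE¹ = 𝓔 − ω²b²/2, vI¹ = 𝓔 + h + μ/b, I₁ = −μ/(4b²√vI¹), ε₁ = (e²/b)·√vI¹, and δ'_{π/2}(h,μ) = −( b²√vE¹ + b·ε₁ − √vE¹ )·( b²√vE¹ + b·(2I₁ + ε₁) − √vE¹ ) / ( b·I₁·√vE¹ ); further define vE⁰ = 𝓔 − ω²/2, vI⁰ = 𝓔 + h + μ, I₀ = −(1−e²)·μ/(4√vI⁰), ε₀ = −e²·√vI⁰, and δ'_0(h,μ) = ( √vE⁰ + b·ε₀ − b²√vE⁰ )·(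 b²√vE⁰ − b·(2I₀ + ε₀) − √vE⁰ ) / ( b·I₀·√vE⁰ ). Then there exists μ̄ > 0 such that for every μ > μ̄ there exists h̄ > 0 such that for every h > h̄ one has δ'_0(h,μ) > 0 and δ'_{π/2}(h,μ) > 0. -/
noncomputable section

/-- Positivity of the derivatives of the free-fall map at the two vertices
of the ellipse for large `μ` and `h`: with `b = √(1−e²)` and `e ∈ (0, 1/√2)`, there exists
`μ̄ > 0` such that for every `μ > μ̄` there exists `h̄ > 0` such that for every `h > h̄` both
`δ'_0(h,μ) > 0` and `δ'_{π/2}(h,μ) > 0`. -/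
theorem free_fall_map_derivatives_positive
    (𝓔 ω e : ℝ) (h𝓔 : 0 < 𝓔) (hω : 0 < ω) (hHill : ω ^ 2 < 2 * 𝓔)
    (he0 : 0 < e) (he1 : e < 1 / Real.sqrt 2) :
    let b := Real.sqrt (1 - e ^ 2)
    let δ0' : ℝ → ℝ → ℝ := fun h μ =>
      (let vE0 := 𝓔 - ω ^ 2 / 2;
       let vI0 := 𝓔 + h + μ;
       let I0 := -(1 - e ^ 2) * μ / (4 * Real.sqrt vI0);
       let ε0 := -e ^ 2 * Real.sqrt vI0;
       (Real.sqrt vE0 + b * ε0 - b ^ 2 * Real.sqrt vE0) *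
           (b ^ 2 * Real.sqrt vE0 - b * (2 * I0 + ε0) - Real.sqrt vE0) /
         (b * I0 * Real.sqrt vE0))
    let δpihalf' : ℝ → ℝ → ℝ := fun h μ =>
      (let vE1 := 𝓔 - ω ^ 2 * b ^ 2 / 2;
       let vI1 := 𝓔 + h + μ / b;
       let I1 := -μ / (4 * b ^ 2 * Real.sqrt vI1);
       let ε1 := e ^ 2 / b * Real.sqrt vI1;
       -((b ^ 2 * Real.sqrt vE1 + b * ε1 - Real.sqrt vE1) *
           (b ^ 2 * Real.sqrt vE1 + b * (2 * I1 + ε1) - Real.sqrt vE1)) /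
         (b * I1 * Real.sqrt vE1))
    ∃ μbar > (0:ℝ), ∀ μ > μbar, ∃ hbar > (0:ℝ), ∀ h > hbar,
      0 < δ0' h μ ∧ 0 < δpihalf' h μ := by
  intro b δ0' δpihalf'
  have he2 : e ^ 2 < 1 := by
    have h2 : (1:ℝ) ≤ Real.sqrt 2 := by
      rw [Real.one_le_sqrt]; norm_num
    have : 1 / Real.sqrt 2 ≤ 1 := by
      rw [div_le_one (by linarith)]; exact h2
    nlinarith
  have hb : 0 < b := Real.sqrt_pos.mpr (by linarith)
  have hb2 : b ^ 2 = 1 - e ^ 2 := Real.sq_sqrt (by linarith)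
  have hee : 0 < e ^ 2 := by positivity
  have hA0 : 0 < Real.sqrt (𝓔 - ω ^ 2 / 2) := Real.sqrt_pos.mpr (by linarith)
  have hA1 : 0 < Real.sqrt (𝓔 - ω ^ 2 * b ^ 2 / 2) := by
    apply Real.sqrt_pos.mpr
    rw [hb2]
    nlinarith [mul_pos (pow_pos hω 2) hee]
  refine ⟨1, one_pos, fun μ hμ => ?_⟩
  have hμ0 : 0 < μ := by linarith
  set A0 := Real.sqrt (𝓔 - ω ^ 2 / 2) with hA0d
  set A1 := Real.sqrt (𝓔 - ω ^ 2 * b ^ 2 / 2) with hA1d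
  have hK : 0 < A0 / b + A1 + 1 + μ / (2 * b * e ^ 2) := by positivity
  refine ⟨(A0 / b + A1 + 1 + μ / (2 * b * e ^ 2)) ^ 2, by positivity, fun h hh => ?_⟩
  have p1 : 0 < A0 / b := by positivity
  have p2 : 0 < μ / (2 * b * e ^ 2) := by positivity
  have p3 : 0 < μ / b := by positivity
  have hs0 : A0 / b + A1 + 1 + μ / (2 * b * e ^ 2) < Real.sqrt (𝓔 + h + μ) :=
    Real.lt_sqrt_of_sq_lt (by linarith)
  have hs1 : A0 / b + A1 + 1 + μ / (2 * b * e ^ 2) < Real.sqrt (𝓔 + h + μ / b) :=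
    Real.lt_sqrt_of_sq_lt (by linarith)
  constructor
  · change 0 < (A0 + b * (-e ^ 2 * Real.sqrt (𝓔 + h + μ)) - b ^ 2 * A0) *
      (b ^ 2 * A0 - b * (2 * (-(1 - e ^ 2) * μ / (4 * Real.sqrt (𝓔 + h + μ))) +
        (-e ^ 2 * Real.sqrt (𝓔 + h + μ))) - A0) /
      (b * (-(1 - e ^ 2) * μ / (4 * Real.sqrt (𝓔 + h + μ))) * A0)
    generalize Real.sqrt (𝓔 + h + μ) = s at *
    have hs : 0 < s := by linarith
    have hbs : A0 < b * s := by
      have : A0 / b < s := by linarith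
      rw [div_lt_iff₀ hb] at this
      linarith
    have hI : -(1 - e ^ 2) * μ / (4 * s) < 0 :=
      div_neg_of_neg_of_pos (by nlinarith) (by positivity)
    generalize -(1 - e ^ 2) * μ / (4 * s) = I at *
    have hbI : b * I < 0 := mul_neg_of_pos_of_neg hb hI
    have key : 0 < e ^ 2 * (b * s - A0) := mul_pos hee (by linarith)
    apply div_pos_of_neg_of_neg
    · apply mul_neg_of_neg_of_pos
      · rw [hb2]; linarith
      · rw [hb2]; linarith
    · exact mul_neg_of_neg_of_pos hbI hA0
  · change 0 < -((b ^ 2 * A1 + b * (e ^ 2 / b * Real.sqrt (𝓔 + h + μ / b)) - A1) *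
      (b ^ 2 * A1 + b * (2 * (-μ / (4 * b ^ 2 * Real.sqrt (𝓔 + h + μ / b))) +
        (e ^ 2 / b * Real.sqrt (𝓔 + h + μ / b))) - A1)) /
      (b * (-μ / (4 * b ^ 2 * Real.sqrt (𝓔 + h + μ / b))) * A1)
    generalize Real.sqrt (𝓔 + h + μ / b) = s at *
    have hs : 1 < s := by linarith
    have hI : -μ / (4 * b ^ 2 * s) < 0 :=
      div_neg_of_neg_of_pos (by linarith) (by positivity)
    have hI2 : -(μ / (2 * b)) < 2 * (b * (-μ / (4 * b ^ 2 * s))) := by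
      have e1 : 2 * (b * (-μ / (4 * b ^ 2 * s))) = -(μ / (2 * b) / s) := by
        field_simp
        norm_num
      rw [e1]
      exact neg_lt_neg (div_lt_self (by positivity) hs)
    generalize -μ / (4 * b ^ 2 * s) = I at *
    have hbI : b * I < 0 := mul_neg_of_pos_of_neg hb hI
    have hε : b * (e ^ 2 / b * s) = e ^ 2 * s := by field_simp
    have key : μ / (2 * b) < e ^ 2 * (s - A1) := by
      have h1 : μ / (2 * b * e ^ 2) < s - A1 := by linarith
      have h2 : μ / (2 * b) = e ^ 2 * (μ / (2 * b * e ^ 2)) := by field_simp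
      rw [h2]
      exact mul_lt_mul_of_pos_left h1 hee
    have p4 : 0 < μ / (2 * b) := by positivity
    apply div_pos_of_neg_of_neg
    · apply neg_neg_of_pos
      apply mul_pos
      · rw [hε, hb2]; linarith
      · rw [mul_add b, hε, hb2]; linarith
    · exact mul_neg_of_neg_of_pos hbI hA1
end
end
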